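/- arXiv:1404.3900 — 2 statements merged into one kernel-verified Lean document; each statement's English description precedes it below -/
import Mathlib

section
/- Let A ⊆ B(H) be a finite-dimensional C*-algebra and A = {A_1,…,A_n} ⊆ A_h a finite sequence of Hermitian elements. Then the diamond norm of the cq-map Φ^cq_A satisfies ‖Φ^cq_A‖_◇ = max_{1≤i≤n} ‖A_i‖_1, where ‖·‖_1 is the trace norm. (The norm ‖·‖_◇ on L(𝔻_n,A) is independent of the choice of admissible family 𝒫.) -/
noncomputable section

open Matrix Complex Filter
open scoped Kronecker ComplexOrder

/-- The algebra `B(H)` of operators on the Hilbert space with orthonormal basis indexed by `ι`,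
modelled as matrices. -/
abbrev Mat (ι : Type) : Type := Matrix ι ι ℂ

/-- The space of all maps `B(H) → B(K)`. -/
abbrev HMap (ι κ : Type) : Type := Mat ι → Mat κ

section Defs
variable {ι κ μ ν γ γ' : Type}

/-- A Hermitian (i.e. complex-linear and Hermiticity preserving) map `B(H) → B(K)`. -/
def IsHermMap [Fintype ι] [Fintype κ] (φ : HMap ι κ) : Prop :=
  IsLinearMap ℂ φ ∧ ∀ a : Mat ι, φ aᴴ = (φ a)ᴴ

/-- The real vector space `L(H,K)` of Hermitian maps, as a subset of all maps. -/
def LHK (ι κ : Type) [Fintype ι] [Fintype κ] : Set (HMap ι κ) := {φ | IsHermMap φ}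

/-- The functional `s(φ) = ∑_{i,j} ⟨e_i, φ(|e_i⟩⟨e_j|) e_j⟩`. -/
def sC [Fintype ι] [DecidableEq ι] (φ : HMap ι ι) : ℂ :=
  ∑ i, ∑ j, φ (Matrix.single i j 1) i j

/-- The duality pairing `⟨φ,ψ⟩ = s(ψ ∘ φ)` between `L(H,K)` and `L(K,H)`. -/
def pairing [Fintype ι] [DecidableEq ι] [Fintype κ] (φ : HMap ι κ) (ψ : HMap κ ι) : ℝ :=
  (sC (ψ ∘ φ)).re

/-- The map `φ ⊗ id_F`. -/
def tensorId (φ : HMap ι κ) (γ : Type) : Mat (ι × γ) → Mat (κ × γ) :=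
  fun M => Matrix.of fun p q => φ (Matrix.of fun i i' => M (i, p.2) (i', q.2)) p.1 q.1

/-- The map `id ⊗ f` on `B(H ⊗ D)`. -/
def idTensor (ι : Type) (f : HMap γ γ') : Mat (ι × γ) → Mat (ι × γ') :=
  fun M => Matrix.of fun p q => f (Matrix.of fun c c' => M (p.1, c) (q.1, c')) p.2 q.2

/-- The tensor product `φ ⊗ ξ` of two maps. -/
def tensorFun [Fintype ι] [DecidableEq ι] (φ : HMap ι κ) (ξ : HMap γ γ') :
    Mat (ι × γ) → Mat (κ × γ') :=
  fun M => Matrix.of fun p q =>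
    ∑ i, ∑ i', φ (Matrix.single i i' 1) p.1 q.1 *
      ξ (Matrix.of fun c c' => M (i, c) (i', c')) p.2 q.2

/-- The Choi matrix `C(φ) = (φ ⊗ id)(X_H)` of a map `φ : B(H) → B(K)`. -/
def Choi [DecidableEq ι] (φ : HMap ι κ) : Mat (κ × ι) :=
  Matrix.of fun p q => φ (Matrix.single p.2 q.2 1) p.1 q.1

/-- The adjoint of a map with respect to the Hilbert-Schmidt inner products. -/
def adjFun [Fintype ι] [Fintype κ] [DecidableEq ι] (φ : HMap ι κ) : HMap κ ι :=
  fun b => Matrix.of fun i j => (φ (Matrix.single j i 1) * b).trace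

/-- Trace preserving maps. -/
def TP [Fintype ι] [Fintype κ] (φ : HMap ι κ) : Prop := ∀ a, (φ a).trace = a.trace

/-- The cone `Pos(H,K)` of positive Hermitian maps. -/
def PosSet (ι κ : Type) [Fintype ι] [Fintype κ] : Set (HMap ι κ) :=
  {φ | IsHermMap φ ∧ ∀ a, a.PosSemidef → (φ a).PosSemidef}

/-- The cone `CP(H,K)` of completely positive Hermitian maps. -/
def CPSet (ι κ : Type) [Fintype ι] [Fintype κ] : Set (HMap ι κ) :=
  {φ | IsHermMap φ ∧ ∀ (n : ℕ) (M : Mat (ι × Fin n)),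
      M.PosSemidef → (tensorId φ (Fin n) M).PosSemidef}

/-- The cone `EB(H,K)` of entanglement breaking maps `a ↦ ∑_i Tr(F_i a) ρ_i`. -/
def EBSet (ι κ : Type) [Fintype ι] [Fintype κ] : Set (HMap ι κ) :=
  {φ | ∃ (N : ℕ) (F : Fin N → Mat ι) (ρ : Fin N → Mat κ),
      (∀ i, (F i).PosSemidef) ∧ (∀ i, (ρ i).PosSemidef) ∧
      φ = fun a => ∑ i, ((F i * a).trace) • ρ i}

/-- Interior of `Q` relative to the subset `L`. -/
def relInt {X : Type*} [TopologicalSpace X] (L Q : Set X) : Set X :=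
  {x | x ∈ Q ∧ Q ∈ nhdsWithin x L}

/-- A proper cone in the (sub)space `L`: closed, convex, closed under nonnegative scalar
multiples, pointed, and with nonempty interior relative to `L`. -/
def IsProperConeIn {X : Type*} [TopologicalSpace X] [AddCommGroup X] [Module ℝ X]
    (L Q : Set X) : Prop :=
  Q ⊆ L ∧ IsClosed Q ∧ Convex ℝ Q ∧ (∀ c : ℝ, 0 ≤ c → ∀ x ∈ Q, c • x ∈ Q) ∧
    (∀ x, x ∈ Q → -x ∈ Q → x = 0) ∧ (relInt L Q).Nonempty

end Defs

/-- An admissible family of positive cones: a proper cone `Pf(H,K) ⊆ L(H,K)` for every pair of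
(finite-dimensional) Hilbert spaces, with `EB ⊆ Pf ⊆ Pos`, closed under composition and under
composition with completely positive maps. -/
structure AdmissibleFamily : Type 1 where
  P : ∀ (ι κ : Type) [Fintype ι] [DecidableEq ι] [Fintype κ] [DecidableEq κ], Set (HMap ι κ)
  proper : ∀ (ι κ : Type) [Fintype ι] [DecidableEq ι] [Fintype κ] [DecidableEq κ],
    IsProperConeIn (LHK ι κ) (P ι κ)
  eb_le : ∀ (ι κ : Type) [Fintype ι] [DecidableEq ι] [Fintype κ] [DecidableEq κ],
    EBSet ι κ ⊆ P ι κ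
  le_pos : ∀ (ι κ : Type) [Fintype ι] [DecidableEq ι] [Fintype κ] [DecidableEq κ],
    P ι κ ⊆ PosSet ι κ
  comp_mem : ∀ (ι κ μ : Type) [Fintype ι] [DecidableEq ι] [Fintype κ] [DecidableEq κ]
      [Fintype μ] [DecidableEq μ],
    ∀ φ ∈ P ι κ, ∀ ψ ∈ P κ μ, (ψ ∘ φ) ∈ P ι μ
  cp_comp_mem : ∀ (ι κ μ ν : Type) [Fintype ι] [DecidableEq ι] [Fintype κ] [DecidableEq κ]
      [Fintype μ] [DecidableEq μ] [Fintype ν] [DecidableEq ν],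
    ∀ β ∈ CPSet ι κ, ∀ φ ∈ P κ μ, ∀ α ∈ CPSet μ ν, (α ∘ φ ∘ β) ∈ P ι ν

structure FdSubalgebra (ι : Type) [Fintype ι] [DecidableEq ι] : Type where
  car : Set (Mat ι)
  add_mem : ∀ {x y}, x ∈ car → y ∈ car → x + y ∈ car
  smul_mem : ∀ (c : ℂ) {x}, x ∈ car → c • x ∈ car
  one_mem : (1 : Mat ι) ∈ car
  mul_mem : ∀ {x y}, x ∈ car → y ∈ car → x * y ∈ car
  star_mem : ∀ {x}, x ∈ car → xᴴ ∈ car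
  E : Mat ι → Mat ι
  E_linear : IsLinearMap ℂ E
  E_mem : ∀ x, E x ∈ car
  E_fix : ∀ x ∈ car, E x = x
  E_trace : ∀ x y, y ∈ car → (E x * y).trace = (x * y).trace

namespace FdSubalgebra

set_option linter.unusedSectionVars false
variable {ι γ : Type} [Fintype ι] [DecidableEq ι] [Fintype γ] [DecidableEq γ]

lemma zero_mem (A : FdSubalgebra ι) : (0 : Mat ι) ∈ A.car := by
  simpa using A.smul_mem 0 A.one_mem

lemma sum_mem (A : FdSubalgebra ι) {α : Type*} {s : Finset α} {f : α → Mat ι}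
    (h : ∀ a ∈ s, f a ∈ A.car) : (∑ a ∈ s, f a) ∈ A.car :=
  Finset.sum_induction f (· ∈ A.car) (fun _ _ hx hy => A.add_mem hx hy) A.zero_mem h

/-- The full matrix algebra `B(H)`. -/
def full (ι : Type) [Fintype ι] [DecidableEq ι] : FdSubalgebra ι where
  car := Set.univ
  add_mem := fun _ _ => Set.mem_univ _
  smul_mem := by intro _ x _; exact Set.mem_univ _
  one_mem := Set.mem_univ _
  mul_mem := fun _ _ => Set.mem_univ _
  star_mem := fun _ => Set.mem_univ _
  E := id
  E_linear := ⟨fun _ _ => rfl, fun _ _ => rfl⟩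
  E_mem := fun _ => trivial
  E_fix := fun _ _ => rfl
  E_trace := fun _ _ _ => rfl

/-- The diagonal subalgebra `𝔻_n ⊆ B(ℂ^n)`. -/
def diag (n : ℕ) : FdSubalgebra (Fin n) where
  car := {M | ∀ i j, i ≠ j → M i j = 0}
  add_mem := by
    intro x y hx hy i j hij
    simp [hx i j hij, hy i j hij]
  smul_mem := by
    intro c x hx i j hij
    simp [hx i j hij]
  one_mem := by
    intro i j hij
    exact Matrix.one_apply_ne hij
  mul_mem := by
    intro x y hx hy i j hij
    show ∑ k, x i k * y k j = 0
    refine Finset.sum_eq_zero fun k _ => ?_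
    rcases eq_or_ne k i with rfl | hk
    · simp [hy k j hij]
    · simp [hx i k (Ne.symm hk)]
  star_mem := by
    intro x hx i j hij
    simp [Matrix.conjTranspose_apply, hx j i (Ne.symm hij)]
  E := fun M => Matrix.diagonal fun i => M i i
  E_linear := by
    constructor
    · intro x y
      ext i j
      by_cases h : i = j <;> simp [Matrix.diagonal, h]
    · intro c x
      ext i j
      by_cases h : i = j <;> simp [Matrix.diagonal, h]
  E_mem := by
    intro x i j hij
    simp [Matrix.diagonal_apply_ne _ hij]
  E_fix := by
    intro x hx
    ext i j
    by_cases h : i = j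
    · subst h; simp
    · simp [Matrix.diagonal_apply_ne _ h, hx i j h]
  E_trace := by
    intro x y hy
    have key : ∀ z : Mat (Fin n), (z * y).trace = ∑ i, z i i * y i i := by
      intro z
      simp only [Matrix.trace, Matrix.diag, Matrix.mul_apply]
      refine Finset.sum_congr rfl fun i _ => ?_
      refine Finset.sum_eq_single i (fun k _ hk => ?_) (by simp)
      simp [hy k i hk]
    rw [key, key]
    refine Finset.sum_congr rfl fun i _ => ?_
    simp


/-- The `(c,d)` block of a matrix on `H ⊗ D`. -/
def blk (M : Mat (ι × γ)) (c d : γ) : Mat ι := Matrix.of fun i j => M (i, c) (j, d)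

lemma blk_add (M N : Mat (ι × γ)) (c d : γ) : blk (M + N) c d = blk M c d + blk N c d := by
  ext i j; simp [blk]

lemma blk_smul (a : ℂ) (M : Mat (ι × γ)) (c d : γ) : blk (a • M) c d = a • blk M c d := by
  ext i j; simp [blk]

lemma blk_mul (M N : Mat (ι × γ)) (c d : γ) :
    blk (M * N) c d = ∑ e, blk M c e * blk N e d := by
  ext i j
  simp only [blk, Matrix.of_apply, Matrix.mul_apply, Matrix.sum_apply, Fintype.sum_prod_type]
  exact Finset.sum_comm

lemma trace_blk (M : Mat (ι × γ)) : M.trace = ∑ c, (blk M c c).trace := by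
  simp only [Matrix.trace, Matrix.diag, blk, Matrix.of_apply, Fintype.sum_prod_type]
  exact Finset.sum_comm

/-- The tensor product algebra `A ⊗ B(D) ⊆ B(H ⊗ D)`. -/
def tensorFull (A : FdSubalgebra ι) (γ : Type) [Fintype γ] [DecidableEq γ] :
    FdSubalgebra (ι × γ) where
  car := {M | ∀ c d, blk M c d ∈ A.car}
  add_mem := by
    intro x y hx hy c d
    rw [blk_add]; exact A.add_mem (hx c d) (hy c d)
  smul_mem := by
    intro a x hx c d
    rw [blk_smul]; exact A.smul_mem a (hx c d)
  one_mem := by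
    intro c d
    rcases eq_or_ne c d with rfl | hcd
    · have : blk (1 : Mat (ι × γ)) c c = 1 := by
        ext i j
        by_cases h : i = j
        · subst h; simp [blk, Matrix.one_apply]
        · simp [blk, Matrix.one_apply, h]
      rw [this]; exact A.one_mem
    · have : blk (1 : Mat (ι × γ)) c d = 0 := by
        ext i j
        simp [blk, Matrix.one_apply, hcd]
      rw [this]; exact A.zero_mem
  mul_mem := by
    intro x y hx hy c d
    rw [blk_mul]
    exact A.sum_mem fun e _ => A.mul_mem (hx c e) (hy e d)
  star_mem := by
    intro x hx c d
    have : blk xᴴ c d = (blk x d c)ᴴ := by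
      ext i j; simp [blk, Matrix.conjTranspose_apply]
    rw [this]; exact A.star_mem (hx d c)
  E := fun M => Matrix.of fun p q => A.E (blk M p.2 q.2) p.1 q.1
  E_linear := by
    constructor
    · intro x y
      ext p q
      simp [blk_add, (A.E_linear.map_add _ _)]
    · intro a x
      ext p q
      simp [blk_smul, (A.E_linear.map_smul _ _)]
  E_mem := by
    intro x c d
    have : blk (Matrix.of fun p q => A.E (blk x p.2 q.2) p.1 q.1) c d = A.E (blk x c d) := by
      ext i j; simp [blk]
    rw [this]; exact A.E_mem _
  E_fix := by
    intro x hx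
    ext p q
    show A.E (blk x p.2 q.2) p.1 q.1 = x p q
    rw [A.E_fix _ (hx p.2 q.2)]
    rfl
  E_trace := by
    intro x y hy
    have key : ∀ z : Mat (ι × γ), (z * y).trace = ∑ c, ∑ d, (blk z c d * blk y d c).trace := by
      intro z
      rw [trace_blk (z * y)]
      refine Finset.sum_congr rfl fun c _ => ?_
      rw [blk_mul, Matrix.trace_sum]
    rw [key, key]
    refine Finset.sum_congr rfl fun c _ => ?_
    refine Finset.sum_congr rfl fun d _ => ?_
    have hblk : blk (Matrix.of fun p q => A.E (blk x p.2 q.2) p.1 q.1) c d = A.E (blk x c d) := by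
      ext i j; simp [blk]
    rw [hblk, A.E_trace _ _ (hy d c)]

end FdSubalgebra


section Main
variable {ι κ μ ν γ γ' : Type}
variable [Fintype ι] [DecidableEq ι] [Fintype κ] [DecidableEq κ]

/-- The subspace `L(A,B)` of maps identified with `E_B ∘ φ ∘ E_A`. -/
def LAB (A : FdSubalgebra ι) (B : FdSubalgebra κ) : Set (HMap ι κ) :=
  {φ | (∀ a, φ a ∈ B.car) ∧ ∀ a, φ (A.E a) = φ a}

/-- The density operators (states) of the algebra `A`. -/
def States (A : FdSubalgebra ι) : Set (Mat ι) :=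
  {σ | σ ∈ A.car ∧ σ.PosSemidef ∧ σ.trace = 1}

/-- The map `Φ_{I,σ} : a ↦ (Tr a) σ`. -/
def PhiI (ι : Type) [Fintype ι] (σ : Mat κ) : HMap ι κ := fun a => a.trace • σ

/-- The cone `Pf(A,B) = Pf(H,K) ∩ L(A,B)`. -/
def PL (Pf : AdmissibleFamily) (A : FdSubalgebra ι) (B : FdSubalgebra κ) : Set (HMap ι κ) :=
  Pf.P ι κ ∩ LAB A B

/-- The set `𝒞(A,B)` of `Pf`-channels, i.e. trace preserving maps in `Pf(A,B)`. -/
def ChanP (Pf : AdmissibleFamily) (A : FdSubalgebra ι) (B : FdSubalgebra κ) : Set (HMap ι κ) :=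
  {φ | φ ∈ PL Pf A B ∧ TP φ}

/-- The dual cone `Pf*(A,B) = Pf*(H,K) ∩ L(A,B)`, where `Pf*(H,K) ⊆ L(H,K)` is the dual cone
of `Pf(K,H)` with respect to the pairing `⟨·,·⟩`. -/
def PstarL (Pf : AdmissibleFamily) (A : FdSubalgebra ι) (B : FdSubalgebra κ) :
    Set (HMap ι κ) :=
  {ψ | IsHermMap ψ ∧ ψ ∈ LAB A B ∧ ∀ χ ∈ Pf.P κ ι, 0 ≤ pairing ψ χ}

/-- The diamond norm `‖φ‖_◇ = inf{λ>0 : ∃ α ∈ 𝒞(A,B), λα ± φ ∈ Pf(A,B)}`. -/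
def dnormP (Pf : AdmissibleFamily) (A : FdSubalgebra ι) (B : FdSubalgebra κ)
    (φ : HMap ι κ) : ℝ :=
  sInf {l : ℝ | 0 < l ∧ ∃ α ∈ ChanP Pf A B,
    (l • α - φ) ∈ PL Pf A B ∧ (l • α + φ) ∈ PL Pf A B}

/-- The dual diamond norm `‖φ‖^◇ = inf{λ>0 : ∃ σ ∈ 𝔖(B), λ Φ_{I,σ} ± φ ∈ Pf*(A,B)}`. -/
def udnormP (Pf : AdmissibleFamily) (A : FdSubalgebra ι) (B : FdSubalgebra κ)
    (φ : HMap ι κ) : ℝ :=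
  sInf {l : ℝ | 0 < l ∧ ∃ σ ∈ States B,
    (l • PhiI ι σ - φ) ∈ PstarL Pf A B ∧ (l • PhiI ι σ + φ) ∈ PstarL Pf A B}

/-- `CP(A,B) = CP(H,K) ∩ L(A,B)`. -/
def CPL (A : FdSubalgebra ι) (B : FdSubalgebra κ) : Set (HMap ι κ) :=
  CPSet ι κ ∩ LAB A B

/-- Completely positive trace preserving channels `A → B`. -/
def ChanCP (A : FdSubalgebra ι) (B : FdSubalgebra κ) : Set (HMap ι κ) :=
  {φ | φ ∈ CPL A B ∧ TP φ}

/-- The dual diamond norm with respect to the family `CP` (recall `CP* = CP`). -/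
def udnormCP (A : FdSubalgebra ι) (B : FdSubalgebra κ) (φ : HMap ι κ) : ℝ :=
  sInf {l : ℝ | 0 < l ∧ ∃ σ ∈ States B,
    (l • PhiI ι σ - φ) ∈ CPL A B ∧ (l • PhiI ι σ + φ) ∈ CPL A B}

/-- The qc-map `Φ^qc_A : b ↦ ∑_i Tr(A_i b) |e_i⟩⟨e_i|` given by operators `A_1, …, A_n`. -/
def PhiQC {n : ℕ} (A : Fin n → Mat ι) : HMap ι (Fin n) :=
  fun b => Matrix.diagonal fun i => (A i * b).trace

/-- The cq-map `Φ^cq_A : x ↦ ∑_i ⟨e_i, x e_i⟩ A_i` given by operators `A_1, …, A_n`. -/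
def PhiCQ {n : ℕ} (A : Fin n → Mat ι) : HMap (Fin n) ι :=
  fun x => ∑ i, x i i • A i

/-- The positive semidefinite square root of a positive semidefinite matrix. -/
def Matrix.PosSemidef.sqrt {n 𝕜 : Type*} [Fintype n] [RCLike 𝕜] [DecidableEq n]
    {A : Matrix n n 𝕜} (hA : A.PosSemidef) : Matrix n n 𝕜 :=
  hA.1.eigenvectorUnitary.1 * Matrix.diagonal ((↑) ∘ Real.sqrt ∘ hA.1.eigenvalues) *
    (star hA.1.eigenvectorUnitary : Matrix n n 𝕜)

/-- The trace norm `‖A‖₁ = Tr √(AᴴA)`. -/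
def traceNorm (A : Mat ι) : ℝ :=
  ((Matrix.posSemidef_conjTranspose_mul_self A).sqrt.trace).re

/-- The operator norm of a matrix. -/
def opNorm (A : Mat ι) : ℝ := ‖Matrix.toEuclideanCLM (𝕜 := ℂ) A‖

/-- The cone `C(~Pf(H,K)) ⊆ B_h(K ⊗ H)` of Choi matrices of adjoints of maps in the dual cone
`Pf*(K,H)`. -/
def tildeCone (Pf : AdmissibleFamily) (ι κ : Type) [Fintype ι] [DecidableEq ι]
    [Fintype κ] [DecidableEq κ] : Set (Mat (κ × ι)) :=
  {X | ∃ ψ : HMap κ ι, IsHermMap ψ ∧ (∀ χ ∈ Pf.P ι κ, 0 ≤ pairing χ ψ) ∧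
    X = Choi (adjFun ψ)}

/-- The base norm `‖X‖_{1,~Pf} = sup{Tr XY : -I ≤_{~Pf} Y ≤_{~Pf} I}` on `B_h(K ⊗ H)`. -/
def oneNormTilde (Pf : AdmissibleFamily) (X : Mat (κ × ι)) : ℝ :=
  sSup {r : ℝ | ∃ Y : Mat (κ × ι), (1 - Y) ∈ tildeCone Pf ι κ ∧ (1 + Y) ∈ tildeCone Pf ι κ ∧
    r = ((X * Y).trace).re}

/-- The order unit norm `‖X‖_C = inf{λ>0 : -λ1 ≤_C X ≤_C λ1}` for a cone `C` of matrices. -/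
def ordUnitNorm {α : Type} [Fintype α] [DecidableEq α] (C : Set (Mat α)) (X : Mat α) : ℝ :=
  sInf {l : ℝ | 0 < l ∧ (l • (1 : Mat α) - X) ∈ C ∧ (l • (1 : Mat α) + X) ∈ C}

open Classical in
/-- `(σ + ε I)^{-1/2}`. -/
def invSqrtShift (σ : Mat κ) (ε : ℝ) : Mat κ :=
  if h : (σ + (ε : ℂ) • 1).PosSemidef then h.sqrt⁻¹ else 0

variable {κ' δ : Type} [Fintype κ'] [DecidableEq κ'] [Fintype δ] [DecidableEq δ]

/-- `Ψ` is `(ε,D)`-post-processing deficient with respect to `Φ` (relative to the family `Pf`):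
for every payoff map `Γ ∈ Pf*(D,A)` and every `α ∈ 𝒞(B,D)` there is `α' ∈ 𝒞(B',D)` with
`⟨α∘Φ,Γ⟩ ≤ ⟨α'∘Ψ,Γ⟩ + ε‖Γ‖^◇`. -/
def PostDeficientP (Pf : AdmissibleFamily) (A : FdSubalgebra ι) (B : FdSubalgebra κ)
    (B' : FdSubalgebra κ') (D : FdSubalgebra δ) (Φ : HMap ι κ) (Ψ : HMap ι κ') (ε : ℝ) :
    Prop :=
  ∀ Γ ∈ PstarL Pf D A, ∀ α ∈ ChanP Pf B D, ∃ α' ∈ ChanP Pf B' D,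
    pairing (α ∘ Φ) Γ ≤ pairing (α' ∘ Ψ) Γ + ε * udnormP Pf D A Γ

/-- Post-processing deficiency for the admissible family `CP` (recall `CP* = CP`). -/
def PostDeficientCP (A : FdSubalgebra ι) (B : FdSubalgebra κ)
    (B' : FdSubalgebra κ') (D : FdSubalgebra δ) (Φ : HMap ι κ) (Ψ : HMap ι κ') (ε : ℝ) :
    Prop :=
  ∀ Γ ∈ CPL D A, ∀ α ∈ ChanCP B D, ∃ α' ∈ ChanCP B' D,
    pairing (α ∘ Φ) Γ ≤ pairing (α' ∘ Ψ) Γ + ε * udnormCP D A Γ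

variable {ι' : Type} [Fintype ι'] [DecidableEq ι']

/-- `Ψ` is `(ε,D)`-pre-processing deficient with respect to `Φ` (relative to `Pf`). -/
def PreDeficientP (Pf : AdmissibleFamily) (A : FdSubalgebra ι) (A' : FdSubalgebra ι')
    (B : FdSubalgebra κ) (D : FdSubalgebra δ) (Φ : HMap ι κ) (Ψ : HMap ι' κ) (ε : ℝ) :
    Prop :=
  ∀ Γ ∈ PstarL Pf B D, ∀ β ∈ ChanP Pf D A, ∃ β' ∈ ChanP Pf D A',
    pairing (Φ ∘ β) Γ ≤ pairing (Ψ ∘ β') Γ + ε * udnormP Pf B D Γ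

/-- Pre-processing deficiency for the admissible family `CP`. -/
def PreDeficientCP (A : FdSubalgebra ι) (A' : FdSubalgebra ι') (B : FdSubalgebra κ)
    (D : FdSubalgebra δ) (Φ : HMap ι κ) (Ψ : HMap ι' κ) (ε : ℝ) : Prop :=
  ∀ Γ ∈ CPL B D, ∀ β ∈ ChanCP D A, ∃ β' ∈ ChanCP D A',
    pairing (Φ ∘ β) Γ ≤ pairing (Ψ ∘ β') Γ + ε * udnormCP B D Γ

/-- `Ψ ⊇_ε Φ`: `sup_{σ ∈ SA} inf_{ρ ∈ SA'} ‖f(σ) - g(ρ)‖₁ ≤ 2ε`. -/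
def SupsetCond {α α' β : Type} [Fintype β] [DecidableEq β] (SA : Set (Mat α)) (SA' : Set (Mat α'))
    (f : Mat α → Mat β) (g : Mat α' → Mat β) (ε : ℝ) : Prop :=
  sSup {r : ℝ | ∃ σ ∈ SA, r = sInf {t : ℝ | ∃ ρ ∈ SA', t = traceNorm (f σ - g ρ)}} ≤ 2 * ε

end Main


section Helpers6
variable {ι : Type} [Fintype ι] [DecidableEq ι]

lemma aux6_aeval_conj (p : Polynomial ℂ) (U : Mat ι) (hU : U * star U = 1) (hU' : star U * U = 1)
    (d : ι → ℂ) :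
    Polynomial.aeval (U * Matrix.diagonal d * star U) p
      = U * Matrix.diagonal (fun i => p.eval (d i)) * star U := by

  have hmul : ∀ X Y : Mat ι, (U * X * star U) * (U * Y * star U) = U * (X * Y) * star U := by
    intro X Y
    calc _ = U * X * (star U * U) * Y * star U := by simp only [Matrix.mul_assoc]
      _ = _ := by rw [hU']; simp only [Matrix.mul_assoc, Matrix.mul_one, Matrix.one_mul]
  induction p using Polynomial.induction_on' with
  | add p q hp hq =>
    rw [map_add, hp, hq, ← Matrix.add_mul, ← Matrix.mul_add, Matrix.diagonal_add]
    simp [Polynomial.eval_add]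
  | monomial k c =>
    have hpow : ∀ k : ℕ, (U * Matrix.diagonal d * star U) ^ k
        = U * Matrix.diagonal (fun i => d i ^ k) * star U := by
      intro k
      induction k with
      | zero => simp [hU]
      | succ k ih =>
        rw [pow_succ, ih, hmul, Matrix.diagonal_mul_diagonal]
        simp [pow_succ]
    rw [Polynomial.aeval_monomial, hpow]
    have : (Matrix.diagonal fun i => Polynomial.eval (d i) (Polynomial.monomial k c))
        = c • Matrix.diagonal (fun i => d i ^ k) := by
      rw [← Matrix.diagonal_smul]; congr 1; ext i; simp
    rw [this, ← Algebra.smul_def]; simp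

lemma aux6_aeval_mem (A : FdSubalgebra ι) (p : Polynomial ℂ) {M : Mat ι} (hM : M ∈ A.car) :
    Polynomial.aeval M p ∈ A.car := by
  induction p using Polynomial.induction_on' with
  | add p q hp hq => rw [map_add]; exact A.add_mem hp hq
  | monomial k c =>
    rw [Polynomial.aeval_monomial, ← Algebra.smul_def]
    refine A.smul_mem c ?_
    induction k with
    | zero => simpa using A.one_mem
    | succ k ih => rw [pow_succ]; exact A.mul_mem ih hM

lemma aux6_spec {M : Mat ι} (h : M.IsHermitian) :
    M = h.eigenvectorUnitary.1 * Matrix.diagonal (fun i => (h.eigenvalues i : ℂ)) *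
      star h.eigenvectorUnitary.1 := by
  conv_lhs => rw [h.spectral_theorem, Unitary.conjStarAlgAut_apply]
  rfl

/-- The absolute value of a Hermitian matrix of the algebra. -/
lemma aux6_abs (A : FdSubalgebra ι) {M : Mat ι} (hM : M ∈ A.car) (h : M.IsHermitian) :
    (Matrix.posSemidef_conjTranspose_mul_self M).sqrt ∈ A.car ∧
    (Matrix.posSemidef_conjTranspose_mul_self M).sqrt =
      h.eigenvectorUnitary.1 * Matrix.diagonal (fun i => ((|h.eigenvalues i| : ℝ) : ℂ)) *
      star h.eigenvectorUnitary.1 := by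
  set hQ := Matrix.posSemidef_conjTranspose_mul_self M
  set U := h.eigenvectorUnitary.1 with hUdef
  have hU : U * star U = 1 := Unitary.mul_star_self_of_mem h.eigenvectorUnitary.2
  have hU' : star U * U = 1 := Unitary.star_mul_self_of_mem h.eigenvectorUnitary.2
  set V := hQ.1.eigenvectorUnitary.1 with hVdef
  have hV : V * star V = 1 := Unitary.mul_star_self_of_mem hQ.1.eigenvectorUnitary.2
  have hV' : star V * V = 1 := Unitary.star_mul_self_of_mem hQ.1.eigenvectorUnitary.2
  have hMs := aux6_spec h
  have hQs := aux6_spec hQ.1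
  rw [← hUdef] at hMs
  rw [← hVdef] at hQs
  let S : Finset ℝ := Finset.univ.image hQ.1.eigenvalues ∪
    Finset.univ.image (fun i => h.eigenvalues i ^ 2)
  let p : Polynomial ℂ := Lagrange.interpolate S (fun x : ℝ => (x : ℂ))
    (fun x : ℝ => ((Real.sqrt x : ℝ) : ℂ))
  have hp : ∀ x ∈ S, p.eval (x : ℂ) = ((Real.sqrt x : ℝ) : ℂ) := by
    intro x hx
    exact Lagrange.eval_interpolate_at_node (v := fun x : ℝ => (x : ℂ)) _
      (fun a _ b _ hab => Complex.ofReal_injective hab) hx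
  have hQ2 : Mᴴ * M = U * Matrix.diagonal (fun i => ((h.eigenvalues i ^ 2 : ℝ) : ℂ)) * star U := by
    rw [h.eq]
    conv_lhs => rw [hMs]
    calc _ = U * Matrix.diagonal (fun i => (h.eigenvalues i : ℂ)) * (star U * U)
          * Matrix.diagonal (fun i => (h.eigenvalues i : ℂ)) * star U := by
            simp only [Matrix.mul_assoc]
      _ = U * (Matrix.diagonal (fun i => (h.eigenvalues i : ℂ))
          * Matrix.diagonal (fun i => (h.eigenvalues i : ℂ))) * star U := by
            rw [hU']; simp only [Matrix.mul_assoc, Matrix.one_mul]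
      _ = _ := by rw [Matrix.diagonal_mul_diagonal]; simp [sq]
  have e1 : Polynomial.aeval (Mᴴ * M) p = hQ.sqrt := by
    conv_lhs => rw [hQs]
    rw [aux6_aeval_conj p V hV hV' _]
    have : (fun i => p.eval (hQ.1.eigenvalues i : ℂ))
        = ((↑) ∘ Real.sqrt ∘ hQ.1.eigenvalues : ι → ℂ) := by
      ext i; rw [hp _ (by simp [S])]; rfl
    rw [this]; rfl
  have e2 : Polynomial.aeval (Mᴴ * M) p
      = U * Matrix.diagonal (fun i => ((|h.eigenvalues i| : ℝ) : ℂ)) * star U := by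
    rw [hQ2, aux6_aeval_conj p U hU hU' _]
    congr 3
    ext i; rw [hp _ (by simp [S]), Real.sqrt_sq_eq_abs]
  refine ⟨?_, e1.symm.trans e2⟩
  rw [← e1]
  exact aux6_aeval_mem A p (A.mul_mem (A.star_mem hM) hM)

lemma aux6_traceNorm {M : Mat ι} (h : M.IsHermitian) :
    traceNorm M = ∑ i, |h.eigenvalues i| := by
  have hU' : star h.eigenvectorUnitary.1 * h.eigenvectorUnitary.1 = 1 :=
    Unitary.star_mul_self_of_mem h.eigenvectorUnitary.2
  unfold traceNorm
  rw [(aux6_abs (FdSubalgebra.full ι) (Set.mem_univ M) h).2, Matrix.mul_assoc, Matrix.trace_mul_comm,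
    Matrix.mul_assoc, hU', Matrix.mul_one, Matrix.trace_diagonal]
  simp

lemma aux6_conj_psd (U : Mat ι) {d : ι → ℝ} (hd : ∀ i, 0 ≤ d i) :
    (U * Matrix.diagonal (fun i => (d i : ℂ)) * star U).PosSemidef := by
  have : (Matrix.diagonal (fun i => (d i : ℂ))).PosSemidef :=
    Matrix.PosSemidef.diagonal (fun i => by simpa using hd i)
  exact this.mul_mul_conjTranspose_same U

lemma aux6_exists (A : FdSubalgebra ι) {M : Mat ι} (hM : M ∈ A.car) (h : M.IsHermitian) :
    ∃ B ∈ A.car, B.PosSemidef ∧ (B - M).PosSemidef ∧ (B + M).PosSemidef ∧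
      B.trace = (traceNorm M : ℂ) := by
  obtain ⟨hm, he⟩ := aux6_abs A hM h
  have hU' : star h.eigenvectorUnitary.1 * h.eigenvectorUnitary.1 = 1 :=
    Unitary.star_mul_self_of_mem h.eigenvectorUnitary.2
  have hs := aux6_spec h
  refine ⟨_, hm, ?_, ?_, ?_, ?_⟩
  · rw [he]; exact aux6_conj_psd _ fun i => abs_nonneg _
  · rw [he]; nth_rw 4 [hs]
    rw [← Matrix.sub_mul, ← Matrix.mul_sub, Matrix.diagonal_sub]
    have := aux6_conj_psd h.eigenvectorUnitary.1
      (d := fun i => |h.eigenvalues i| - h.eigenvalues i) (fun i => sub_nonneg.2 (le_abs_self _))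
    simpa using this
  · rw [he]; nth_rw 4 [hs]
    rw [← Matrix.add_mul, ← Matrix.mul_add, Matrix.diagonal_add]
    have := aux6_conj_psd h.eigenvectorUnitary.1
      (d := fun i => |h.eigenvalues i| + h.eigenvalues i)
      (fun i => by linarith [neg_abs_le (h.eigenvalues i)])
    simpa using this
  · rw [aux6_traceNorm h, he, Matrix.mul_assoc, Matrix.trace_mul_comm,
      Matrix.mul_assoc, hU', Matrix.mul_one, Matrix.trace_diagonal]
    simp

lemma aux6_lower {M B : Mat ι} (h : M.IsHermitian) (h1 : (B - M).PosSemidef)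
    (h2 : (B + M).PosSemidef) : traceNorm M ≤ B.trace.re := by
  have hU : h.eigenvectorUnitary.1 * star h.eigenvectorUnitary.1 = 1 :=
    Unitary.mul_star_self_of_mem h.eigenvectorUnitary.2
  have hU' : star h.eigenvectorUnitary.1 * h.eigenvectorUnitary.1 = 1 :=
    Unitary.star_mul_self_of_mem h.eigenvectorUnitary.2
  have hs := aux6_spec h
  rw [aux6_traceNorm h]
  set U := h.eigenvectorUnitary.1
  have hd : star U * M * U = Matrix.diagonal (fun i => (h.eigenvalues i : ℂ)) := by
    conv_lhs => rw [hs]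
    calc _ = (star U * U) * Matrix.diagonal (fun i => (h.eigenvalues i : ℂ)) * (star U * U) := by
            simp only [Matrix.mul_assoc]
      _ = _ := by rw [hU', Matrix.one_mul, Matrix.mul_one]
  have ht : B.trace = (star U * B * U).trace := by
    rw [Matrix.trace_mul_comm, ← Matrix.mul_assoc, hU, Matrix.one_mul]
  have g1 := h1.conjTranspose_mul_mul_same U
  have g2 := h2.conjTranspose_mul_mul_same U
  rw [← Matrix.star_eq_conjTranspose, Matrix.mul_sub, Matrix.sub_mul, hd] at g1
  rw [← Matrix.star_eq_conjTranspose, Matrix.mul_add, Matrix.add_mul, hd] at g2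
  rw [ht, Matrix.trace, Complex.re_sum]
  refine Finset.sum_le_sum fun i _ => ?_
  have k1 := (Complex.le_def.1 (g1.diag_nonneg (i := i))).1
  have k2 := (Complex.le_def.1 (g2.diag_nonneg (i := i))).1
  simp at k1 k2
  rw [abs_le]
  simp only [Matrix.diag]
  constructor <;> linarith

lemma aux6_mem_PL (Pf : AdmissibleFamily) (A : FdSubalgebra ι) {n : ℕ} (B : Fin n → Mat ι)
    (hB : ∀ i, B i ∈ A.car) (hp : ∀ i, (B i).PosSemidef) :
    PhiCQ B ∈ PL Pf (FdSubalgebra.diag n) A := by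
  refine ⟨Pf.eb_le _ _ ⟨n, fun i => Matrix.single i i 1, B, ?_, hp, ?_⟩, ?_, ?_⟩
  · intro i
    beta_reduce
    rw [← Matrix.diagonal_single]
    refine Matrix.PosSemidef.diagonal (fun j => ?_)
    by_cases hij : j = i
    · subst hij; simp
    · simp [hij]
  · funext a
    unfold PhiCQ
    refine Finset.sum_congr rfl fun i _ => ?_
    have : (Matrix.single i i (1 : ℂ) * a).trace = a i i := by
      rw [← Matrix.diagonal_single]
      simp [Matrix.trace, Matrix.diag, Matrix.diagonal_mul, Pi.single_apply]
    rw [this]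
  · intro a
    exact A.sum_mem fun i _ => A.smul_mem _ (hB i)
  · intro a
    simp [PhiCQ, FdSubalgebra.diag]

lemma aux6_single {n : ℕ} (B : Fin n → Mat ι) (i : Fin n) :
    PhiCQ B (Matrix.single i i 1) = B i := by
  unfold PhiCQ
  rw [Finset.sum_eq_single i]
  · simp
  · intro j _ hj; simp [Matrix.single_apply, hj.symm]
  · simp

end Helpers6

/-- `‖Φ^cq_A‖_◇ = max_i ‖A_i‖₁` for `A = {A_1,…,A_n} ⊆ A_h`.
(The statement holds for an arbitrary admissible family `𝒫`, hence the norm does not depend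
on the choice of `𝒫`.) -/
theorem statement6 (Pf : AdmissibleFamily) {ι : Type} [Fintype ι] [DecidableEq ι]
    (A : FdSubalgebra ι) {n : ℕ} [NeZero n] (Av : Fin n → Mat ι)
    (hmem : ∀ i, Av i ∈ A.car) (hherm : ∀ i, (Av i).IsHermitian) :
    dnormP Pf (FdSubalgebra.diag n) A (PhiCQ Av) = ⨆ i, traceNorm (Av i) := by
  set S := {l : ℝ | 0 < l ∧ ∃ α ∈ ChanP Pf (FdSubalgebra.diag n) A,
    (l • α - PhiCQ Av) ∈ PL Pf (FdSubalgebra.diag n) A ∧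
    (l • α + PhiCQ Av) ∈ PL Pf (FdSubalgebra.diag n) A} with hS
  have hbdd : BddAbove (Set.range fun i => traceNorm (Av i)) := Set.finite_range _ |>.bddAbove
  have hnn : ∀ i, 0 ≤ traceNorm (Av i) := fun i => by
    rw [aux6_traceNorm (hherm i)]; exact Finset.sum_nonneg fun _ _ => abs_nonneg _
  have hM0 : 0 ≤ ⨆ i, traceNorm (Av i) := Real.iSup_nonneg hnn
  have hlow : ∀ l ∈ S, ⨆ i, traceNorm (Av i) ≤ l := by
    rintro l ⟨hl, α, ⟨hα, hTP⟩, h1, h2⟩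
    refine ciSup_le fun i => ?_
    have hps : (Matrix.single i i (1 : ℂ)).PosSemidef := by
      rw [← Matrix.diagonal_single]
      refine Matrix.PosSemidef.diagonal (fun j => ?_)
      by_cases hij : j = i
      · subst hij; simp
      · simp [hij]
    have k1 := (Pf.le_pos _ _ h1.1).2 _ hps
    have k2 := (Pf.le_pos _ _ h2.1).2 _ hps
    rw [Pi.sub_apply, Pi.smul_apply, aux6_single] at k1
    rw [Pi.add_apply, Pi.smul_apply, aux6_single] at k2
    have := aux6_lower (hherm i) k1 k2
    rw [Matrix.trace_smul, hTP, Matrix.trace_single_eq_same] at this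
    simpa using this
  show sInf S = _
  rcases isEmpty_or_nonempty ι with hι | hι
  · have hSe : S = ∅ := by
      ext l
      simp only [Set.mem_empty_iff_false, iff_false]
      rintro ⟨_, α, ⟨_, hTP⟩, _⟩
      have := hTP (Matrix.single 0 0 1)
      rw [Matrix.trace_single_eq_same] at this
      simp [Matrix.trace] at this
    rw [hSe, Real.sInf_empty]
    have : ∀ i, traceNorm (Av i) = 0 := fun i => by simp [traceNorm, Matrix.trace]
    simp [this]
  have hup : ∀ l, (⨆ i, traceNorm (Av i)) < l → l ∈ S := by
    intro l hl
    have hl0 : 0 < l := hM0.trans_lt hl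
    have hle : ∀ i, traceNorm (Av i) ≤ l := fun i => (le_ciSup hbdd i).trans hl.le
    choose B hB hBp hBm hBq hBt using fun i => aux6_exists A (hmem i) (hherm i)
    let c : Fin n → ℝ := fun i => (l - traceNorm (Av i)) / Fintype.card ι
    have hc : ∀ i, 0 ≤ c i := fun i => div_nonneg (sub_nonneg.2 (hle i)) (Nat.cast_nonneg _)
    have hcard : (Fintype.card ι : ℂ) ≠ 0 := by exact_mod_cast Fintype.card_ne_zero
    let R : Fin n → Mat ι := fun i => (c i : ℂ) • (1 : Mat ι)
    have hR : ∀ i, R i ∈ A.car := fun i => A.smul_mem _ A.one_mem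
    have hRp : ∀ i, (R i).PosSemidef := fun i =>
      Matrix.PosSemidef.one.smul (by simpa using hc i)
    let σ : Fin n → Mat ι := fun i => ((l⁻¹ : ℝ) : ℂ) • (B i + R i)
    have hlσ : ∀ i, l • σ i = B i + R i := by
      intro i
      ext a b
      have : (l : ℂ) ≠ 0 := by exact_mod_cast hl0.ne'
      simp [σ]
      field_simp
    have hlPhi : l • PhiCQ σ = PhiCQ (fun i => B i + R i) := by
      funext x
      simp only [PhiCQ, Pi.smul_apply, Finset.smul_sum]
      refine Finset.sum_congr rfl fun i _ => ?_
      rw [smul_comm, hlσ]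
    refine ⟨hl0, PhiCQ σ, ⟨aux6_mem_PL Pf A σ
      (fun i => A.smul_mem _ (A.add_mem (hB i) (hR i)))
      (fun i => ((hBp i).add (hRp i)).smul (by simpa using hl0.le)), ?_⟩, ?_, ?_⟩
    · intro a
      simp only [PhiCQ, Matrix.trace_sum, Matrix.trace_smul]
      simp only [Matrix.trace, Matrix.diag] 
      refine Finset.sum_congr rfl fun i _ => ?_
      have : (σ i).trace = 1 := by
        have hl' : (l : ℂ) ≠ 0 := by exact_mod_cast hl0.ne'
        simp only [σ, R, c, Matrix.trace_smul, Matrix.trace_add, hBt, Matrix.trace_one]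
        push_cast
        simp only [smul_eq_mul]
        field_simp
        ring
      simp only [Matrix.trace, Matrix.diag] at this
      rw [this]; simp
    · rw [hlPhi]
      have : PhiCQ (fun i => B i + R i) - PhiCQ Av = PhiCQ (fun i => (B i - Av i) + R i) := by
        funext x
        simp only [PhiCQ, Pi.sub_apply, ← Finset.sum_sub_distrib, ← smul_sub]
        refine Finset.sum_congr rfl fun i _ => ?_
        congr 1; abel
      rw [this]
      refine aux6_mem_PL Pf A _ (fun i => A.add_mem ?_ (hR i)) (fun i => (hBm i).add (hRp i))
      have := A.add_mem (hB i) (A.smul_mem (-1) (hmem i))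
      simpa [sub_eq_add_neg] using this
    · rw [hlPhi]
      have : PhiCQ (fun i => B i + R i) + PhiCQ Av = PhiCQ (fun i => (B i + Av i) + R i) := by
        funext x
        simp only [PhiCQ, Pi.add_apply, ← Finset.sum_add_distrib, ← smul_add]
        refine Finset.sum_congr rfl fun i _ => ?_
        congr 1; abel
      rw [this]
      exact aux6_mem_PL Pf A _ (fun i => A.add_mem (A.add_mem (hB i) (hmem i)) (hR i))
        (fun i => (hBq i).add (hRp i))
  apply le_antisymm
  · refine le_of_forall_gt_imp_ge_of_dense fun l hl => ?_
    exact csInf_le ⟨0, fun x hx => hx.1.le⟩ (hup l hl)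
  · exact le_csInf ⟨_, hup _ (lt_add_one _)⟩ hlow
end
end

section
/- Let A ⊆ B(H) be a finite-dimensional C*-algebra and A = {A_1,…,A_n} ⊆ A_h a finite sequence of Hermitian elements. Then the diamond norm of the qc-map Φ^qc_A satisfies ‖Φ^qc_A‖_◇ = sup_{σ∈𝔖(A)} ∑_{i=1}^n ‖σ^{1/2} A_i σ^{1/2}‖_1, where the supremum is over density operators σ in A and ‖·‖_1 is the trace norm. -/
noncomputable section

open Matrix Complex Filter
open scoped Kronecker ComplexOrder

section Helpers
variable {ι : Type} [Fintype ι] [DecidableEq ι]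

lemma aux_spectral {X : Mat ι} (hX : X.IsHermitian) :
    ∃ (U : Mat ι) (d : ι → ℝ), Uᴴ * U = 1 ∧ U * Uᴴ = 1 ∧
      X = U * Matrix.diagonal (fun k => (d k : ℂ)) * Uᴴ := by
  refine ⟨hX.eigenvectorUnitary.1, hX.eigenvalues, ?_, ?_, ?_⟩
  · exact Unitary.coe_star_mul_self hX.eigenvectorUnitary
  · exact Unitary.coe_mul_star_self hX.eigenvectorUnitary
  · exact hX.spectral_theorem

lemma aux_conj_diag_psd (U : Mat ι) (d : ι → ℝ) (hd : ∀ k, 0 ≤ d k) :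
    (U * Matrix.diagonal (fun k => (d k : ℂ)) * Uᴴ).PosSemidef := by
  apply Matrix.PosSemidef.mul_mul_conjTranspose_same
  rw [Matrix.posSemidef_diagonal_iff]
  intro k
  exact_mod_cast hd k

lemma aux_conj_mul {U : Mat ι} (hU : Uᴴ * U = 1) (d e : ι → ℂ) :
    (U * Matrix.diagonal d * Uᴴ) * (U * Matrix.diagonal e * Uᴴ) =
      U * Matrix.diagonal (fun k => d k * e k) * Uᴴ := by
  have : (U * Matrix.diagonal d * Uᴴ) * (U * Matrix.diagonal e * Uᴴ) =
      U * Matrix.diagonal d * (Uᴴ * U) * Matrix.diagonal e * Uᴴ := by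
    simp only [Matrix.mul_assoc]
  rw [this, hU, Matrix.mul_one, Matrix.mul_assoc U, Matrix.diagonal_mul_diagonal]

lemma aux_conj_trace {U : Mat ι} (hU : Uᴴ * U = 1) (d : ι → ℂ) :
    (U * Matrix.diagonal d * Uᴴ).trace = ∑ k, d k := by
  rw [Matrix.trace_mul_comm, ← Matrix.mul_assoc, hU, Matrix.one_mul, Matrix.trace_diagonal]

lemma aux_sqrt_psd {A : Mat ι} (hA : A.PosSemidef) : hA.sqrt.PosSemidef :=
  aux_conj_diag_psd hA.1.eigenvectorUnitary.1 (fun k => Real.sqrt (hA.1.eigenvalues k))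
    (fun k => Real.sqrt_nonneg _)

lemma aux_sqrt_mul {A : Mat ι} (hA : A.PosSemidef) : hA.sqrt * hA.sqrt = A := by
  have h1 : (hA.1.eigenvectorUnitary.1)ᴴ * hA.1.eigenvectorUnitary.1 = 1 :=
    Unitary.coe_star_mul_self hA.1.eigenvectorUnitary
  have h2 := aux_conj_mul h1 (fun k => ((Real.sqrt (hA.1.eigenvalues k) : ℝ) : ℂ))
    (fun k => ((Real.sqrt (hA.1.eigenvalues k) : ℝ) : ℂ))
  have h3 : A = hA.1.eigenvectorUnitary.1 *
      Matrix.diagonal (fun k => (hA.1.eigenvalues k : ℂ)) * (hA.1.eigenvectorUnitary.1)ᴴ :=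
    hA.1.spectral_theorem
  refine h2.trans ?_
  conv_rhs => rw [h3]
  congr 3
  funext k
  rw [← Complex.ofReal_mul, Real.mul_self_sqrt (hA.eigenvalues_nonneg k)]

open scoped MatrixOrder in
lemma aux_sqrt_unique {P Q : Mat ι} (hP : P.PosSemidef) (hQ : Q.PosSemidef)
    (h : P * P = Q * Q) : P = Q := by
  exact (CFC.sqrt_unique h hP.nonneg).symm.trans (CFC.sqrt_unique rfl hQ.nonneg)

/-- The absolute value of a Hermitian matrix, in the eigenbasis. -/
lemma aux_abs {X : Mat ι} (hX : X.IsHermitian) {U : Mat ι} {d : ι → ℝ} (hU : Uᴴ * U = 1)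
    (hXU : X = U * Matrix.diagonal (fun k => (d k : ℂ)) * Uᴴ) :
    (Matrix.posSemidef_conjTranspose_mul_self X).sqrt =
      U * Matrix.diagonal (fun k => ((|d k| : ℝ) : ℂ)) * Uᴴ := by
  apply aux_sqrt_unique (aux_sqrt_psd _) (aux_conj_diag_psd _ _ (fun k => abs_nonneg _))
  rw [aux_sqrt_mul, hX.eq, aux_conj_mul hU]
  conv_lhs => rw [hXU]
  rw [aux_conj_mul hU]
  congr 3
  funext k
  rw [← Complex.ofReal_mul, ← Complex.ofReal_mul, abs_mul_abs_self]

lemma aux_abs_psd {X : Mat ι} (hX : X.IsHermitian) :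
    ((Matrix.posSemidef_conjTranspose_mul_self X).sqrt - X).PosSemidef ∧
    ((Matrix.posSemidef_conjTranspose_mul_self X).sqrt + X).PosSemidef := by
  obtain ⟨U, d, hU, _, hXU⟩ := aux_spectral hX
  rw [aux_abs hX hU hXU]
  constructor
  · have := aux_conj_diag_psd U (fun k => |d k| - d k) (fun k => sub_nonneg.2 (le_abs_self _))
    convert this using 1
    conv_lhs => rw [hXU]
    rw [← Matrix.sub_mul, ← Matrix.mul_sub, Matrix.diagonal_sub]
    simp
  · have := aux_conj_diag_psd U (fun k => |d k| + d k)
      (fun k => by linarith [neg_abs_le (d k)])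
    convert this using 1
    conv_lhs => rw [hXU]
    rw [← Matrix.add_mul, ← Matrix.mul_add, Matrix.diagonal_add]
    simp

lemma aux_traceNorm_nonneg (X : Mat ι) : 0 ≤ traceNorm X :=
  (Complex.le_def.1 (aux_sqrt_psd (Matrix.posSemidef_conjTranspose_mul_self X)).trace_nonneg).1

lemma aux_traceNorm_le {X B : Mat ι} (hX : X.IsHermitian) (h1 : (B - X).PosSemidef)
    (h2 : (B + X).PosSemidef) : traceNorm X ≤ B.trace.re := by
  obtain ⟨U, d, hU, hU', hXU⟩ := aux_spectral hX
  have hT : traceNorm X = ∑ k, |d k| := by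
    rw [traceNorm, aux_abs hX hU hXU, aux_conj_trace hU]
    simp
  have hB : B.trace = (Uᴴ * B * U).trace := by
    rw [Matrix.trace_mul_comm, ← Matrix.mul_assoc, hU', Matrix.one_mul]
  have hXd : Uᴴ * X * U = Matrix.diagonal (fun k => (d k : ℂ)) := by
    rw [hXU]
    have : Uᴴ * (U * Matrix.diagonal (fun k => (d k : ℂ)) * Uᴴ) * U =
      (Uᴴ * U) * Matrix.diagonal (fun k => (d k : ℂ)) * (Uᴴ * U) := by
      simp only [Matrix.mul_assoc]
    rw [this, hU, Matrix.one_mul, Matrix.mul_one]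
  have h1' := h1.conjTranspose_mul_mul_same U
  have h2' := h2.conjTranspose_mul_mul_same U
  rw [Matrix.mul_sub, Matrix.sub_mul, hXd] at h1'
  rw [Matrix.mul_add, Matrix.add_mul, hXd] at h2'
  rw [hT, hB, Matrix.trace, Complex.re_sum]
  refine Finset.sum_le_sum fun k _ => ?_
  have a1 := (Complex.le_def.1 (h1'.diag_nonneg (i := k))).1
  have a2 := (Complex.le_def.1 (h2'.diag_nonneg (i := k))).1
  simp only [Matrix.sub_apply, Matrix.add_apply, Matrix.diagonal_apply_eq, Complex.sub_re,
    Complex.add_re, Complex.ofReal_re, Complex.zero_re] at a1 a2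
  rw [Matrix.diag_apply, abs_le]
  constructor <;> linarith

/-- A Hermitian matrix is dominated by its Hilbert-Schmidt norm. -/
lemma aux_hs_bound {D : Mat ι} (hD : D.IsHermitian) {c : ℝ} (hc : 0 ≤ c)
    (h : (D * D).trace.re ≤ c ^ 2) : (c • (1 : Mat ι) - D).PosSemidef := by
  obtain ⟨U, d, hU, hU', hXU⟩ := aux_spectral hD
  have hs : (D * D).trace.re = ∑ k, d k ^ 2 := by
    rw [hXU, aux_conj_mul hU, aux_conj_trace hU, Complex.re_sum]
    refine Finset.sum_congr rfl fun k _ => ?_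
    rw [← Complex.ofReal_mul, Complex.ofReal_re, sq]
  have hd : ∀ k, 0 ≤ c - d k := by
    intro k
    have : d k ^ 2 ≤ ∑ k, d k ^ 2 :=
      Finset.single_le_sum (f := fun k => d k ^ 2) (fun i _ => sq_nonneg _) (Finset.mem_univ k)
    have : |d k| ≤ c := abs_le_of_sq_le_sq (by linarith) hc
    linarith [le_abs_self (d k)]
  have := aux_conj_diag_psd U (fun k => c - d k) hd
  convert this using 1
  conv_lhs => rw [hXU]
  have e1 : c • (1 : Mat ι) = U * Matrix.diagonal (fun _ => (c : ℂ)) * Uᴴ := by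
    rw [← Complex.coe_smul c (1 : Mat ι), ← Matrix.smul_one_eq_diagonal, Matrix.mul_smul, Matrix.mul_one, Matrix.smul_mul, hU']
  rw [e1, ← Matrix.sub_mul, ← Matrix.mul_sub, Matrix.diagonal_sub]
  simp

lemma aux_trace_mul_psd {P Q : Mat ι} (hP : P.PosSemidef) (hQ : Q.PosSemidef) :
    0 ≤ (P * Q).trace.re := by
  have h1 : (P * Q).trace = (hQ.sqrt * P * hQ.sqrtᴴ).trace := by
    rw [(aux_sqrt_psd hQ).1.eq, Matrix.trace_mul_comm (hQ.sqrt * P), ← Matrix.mul_assoc, aux_sqrt_mul,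
      Matrix.trace_mul_comm]
  rw [h1]
  exact (Complex.le_def.1 (hP.mul_mul_conjTranspose_same _).trace_nonneg).1

lemma aux_trace_vec (H : Mat ι) (x : ι → ℂ) :
    (H * Matrix.vecMulVec x (star x)).trace = star x ⬝ᵥ (H *ᵥ x) := by
  rw [Matrix.mul_vecMulVec, Matrix.trace_vecMulVec, dotProduct_comm]

lemma aux_psd_of_trace {H : Mat ι} (hH : H.IsHermitian)
    (h : ∀ Q : Mat ι, Q.PosSemidef → 0 ≤ (H * Q).trace.re) : H.PosSemidef := by
  refine Matrix.PosSemidef.of_dotProduct_mulVec_nonneg hH fun x => ?_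
  have h1 := h _ (Matrix.posSemidef_vecMulVec_self_star x)
  rw [aux_trace_vec] at h1
  rw [Complex.le_def]
  refine ⟨h1, ?_⟩
  have := hH.im_star_dotProduct_mulVec_self x
  simpa using this.symm

/-- Functionals on matrices are given by the trace. -/
lemma aux_rep (g : Mat ι → ℂ) (hg : IsLinearMap ℂ g) (a : Mat ι) :
    g a = ((Matrix.of fun j k => g (Matrix.single k j 1)) * a).trace := by
  have h1 : g a = ∑ i, ∑ j, a i j * g (Matrix.single i j 1) := by
    conv_lhs => rw [Matrix.matrix_eq_sum_single a]
    rw [← IsLinearMap.mk'_apply hg, map_sum]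
    refine Finset.sum_congr rfl fun i _ => ?_
    rw [map_sum]
    refine Finset.sum_congr rfl fun j _ => ?_
    rw [← smul_eq_mul, ← IsLinearMap.mk'_apply hg, ← map_smul, Matrix.smul_single]
    simp
  rw [h1, Matrix.trace, Finset.sum_comm]
  refine Finset.sum_congr rfl fun i _ => ?_
  rw [Matrix.diag_apply, Matrix.mul_apply]
  refine Finset.sum_congr rfl fun j _ => ?_
  rw [Matrix.of_apply, mul_comm]

lemma aux_E_star (A : FdSubalgebra ι) (x : Mat ι) : A.E xᴴ = (A.E x)ᴴ := by
  have hz : A.E xᴴ - (A.E x)ᴴ ∈ A.car := by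
    have := A.add_mem (A.E_mem xᴴ) (A.smul_mem (-1) (A.star_mem (A.E_mem x)))
    simpa [sub_eq_add_neg] using this
  have key : ∀ y ∈ A.car, ((A.E xᴴ - (A.E x)ᴴ) * y).trace = 0 := by
    intro y hy
    rw [Matrix.sub_mul, Matrix.trace_sub, A.E_trace _ _ hy]
    have h1 : ((A.E x)ᴴ * y).trace = star ((A.E x * yᴴ).trace) := by
      rw [← Matrix.trace_conjTranspose, Matrix.conjTranspose_mul, Matrix.conjTranspose_conjTranspose,
        Matrix.trace_mul_comm]
    rw [h1, A.E_trace _ _ (A.star_mem hy), ← Matrix.trace_conjTranspose, Matrix.conjTranspose_mul,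
      Matrix.conjTranspose_conjTranspose, Matrix.trace_mul_comm y, sub_self]
  have := key _ (A.star_mem hz)
  rw [Matrix.trace_mul_conjTranspose_self_eq_zero_iff] at this
  exact sub_eq_zero.1 this

lemma aux_aeval_mem (A : FdSubalgebra ι) {y : Mat ι} (hy : y ∈ A.car) (q : Polynomial ℂ) :
    Polynomial.aeval y q ∈ A.car := by
  induction q using Polynomial.induction_on' with
  | add p q hp hq => rw [map_add]; exact A.add_mem hp hq
  | monomial n a =>
    rw [Polynomial.aeval_monomial, Algebra.algebraMap_eq_smul_one, smul_mul_assoc, one_mul]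
    apply A.smul_mem
    induction n with
    | zero => rw [pow_zero]; exact A.one_mem
    | succ n ih => rw [pow_succ]; exact A.mul_mem ih hy

lemma aux_aeval_conj {U : Mat ι} (hU : Uᴴ * U = 1) (hU' : U * Uᴴ = 1) (d : ι → ℂ)
    (q : Polynomial ℂ) :
    Polynomial.aeval (U * Matrix.diagonal d * Uᴴ) q =
      U * Matrix.diagonal (fun k => q.eval (d k)) * Uᴴ := by
  induction q using Polynomial.induction_on' with
  | add p q hp hq =>
    rw [map_add, hp, hq, ← Matrix.add_mul, ← Matrix.mul_add, Matrix.diagonal_add]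
    simp
  | monomial n a =>
    have hpow : (U * Matrix.diagonal d * Uᴴ) ^ n =
        U * Matrix.diagonal (fun k => d k ^ n) * Uᴴ := by
      induction n with
      | zero => simp [hU']
      | succ n ih => rw [pow_succ, ih, aux_conj_mul hU]; simp [pow_succ]
    rw [Polynomial.aeval_monomial, Algebra.algebraMap_eq_smul_one, smul_mul_assoc, one_mul, hpow,
      ← Matrix.smul_mul, ← Matrix.mul_smul, ← Matrix.diagonal_smul]
    simp only [Polynomial.eval_monomial]
    rfl

lemma aux_E_psd (A : FdSubalgebra ι) {x : Mat ι} (hx : x.PosSemidef) : (A.E x).PosSemidef := by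
  have hH : (A.E x).IsHermitian := by
    unfold Matrix.IsHermitian
    rw [← aux_E_star, hx.1.eq]
  obtain ⟨U, d, hU, hU', hXU⟩ := aux_spectral hH
  set q : Polynomial ℂ := Lagrange.interpolate (Finset.univ.image (fun k => (d k : ℂ))) id
    (fun z => if z.re < 0 then 1 else 0) with hq
  have hqe : ∀ k, q.eval (d k : ℂ) = if d k < 0 then 1 else 0 := by
    intro k
    have := Lagrange.eval_interpolate_at_node (s := Finset.univ.image (fun k => (d k : ℂ)))
      (v := id) (fun z : ℂ => if z.re < 0 then (1 : ℂ) else 0) (Set.injOn_id _)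
      (Finset.mem_image_of_mem _ (Finset.mem_univ k))
    exact this.trans (by simp)
  have hmem := aux_aeval_mem A (A.E_mem x) q
  have hval : Polynomial.aeval (A.E x) q =
      U * Matrix.diagonal (fun k => (((if d k < 0 then 1 else 0 : ℝ)) : ℂ)) * Uᴴ := by
    rw [hXU, aux_aeval_conj hU hU']
    congr 3
    funext k
    rw [hqe]
    split_ifs <;> simp
  have hpsd : (Polynomial.aeval (A.E x) q).PosSemidef := by
    rw [hval]
    apply aux_conj_diag_psd
    intro k
    split_ifs <;> norm_num
  have h1 := aux_trace_mul_psd hx hpsd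
  rw [← A.E_trace _ _ hmem, hval] at h1
  conv at h1 => rw [hXU]
  rw [aux_conj_mul hU, aux_conj_trace hU, Complex.re_sum] at h1
  have hd : ∀ k, 0 ≤ d k := by
    have h2 : ∀ k ∈ Finset.univ, ((d k : ℂ) * ((if d k < 0 then 1 else 0 : ℝ) : ℂ)).re ≤ 0 := by
      intro k _
      rw [← Complex.ofReal_mul, Complex.ofReal_re]
      split_ifs with h
      · linarith
      · simp
    have h3 := (Finset.sum_eq_zero_iff_of_nonpos h2).1 (le_antisymm (Finset.sum_nonpos h2) h1)
    intro k
    have h4 := h3 k (Finset.mem_univ k)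
    rw [← Complex.ofReal_mul, Complex.ofReal_re] at h4
    by_contra hlt
    rw [if_pos (not_le.1 hlt)] at h4
    linarith
  rw [hXU]
  exact aux_conj_diag_psd U d hd

lemma aux_E_trace' (A : FdSubalgebra ι) (x : Mat ι) : (A.E x).trace = x.trace := by
  simpa using A.E_trace x 1 A.one_mem

lemma aux_E_symm (A : FdSubalgebra ι) (x y : Mat ι) :
    (A.E x * y).trace = (x * A.E y).trace := by
  rw [← A.E_trace x _ (A.E_mem y), Matrix.trace_mul_comm (A.E x) (A.E y),
    A.E_trace _ _ (A.E_mem x), Matrix.trace_mul_comm]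

lemma aux_E_sub (A : FdSubalgebra ι) (x y : Mat ι) : A.E (x - y) = A.E x - A.E y := by
  have := map_sub (IsLinearMap.mk' _ A.E_linear) x y
  simpa using this

lemma aux_E_sum (A : FdSubalgebra ι) {n : ℕ} (x : Fin n → Mat ι) :
    A.E (∑ i, x i) = ∑ i, A.E (x i) := by
  exact map_sum (IsLinearMap.mk' _ A.E_linear) x Finset.univ

/-- Pairs `B_i ≥ ± A_i`. -/
def AuxDom {n : ℕ} (Av B : Fin n → Mat ι) : Prop :=
  ∀ i, (B i - Av i).PosSemidef ∧ (B i + Av i).PosSemidef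

/-- The open convex set to be separated from `l • 1`. -/
def AuxK {n : ℕ} (Av : Fin n → Mat ι) : Set (Mat ι) :=
  {T | ∃ B : Fin n → Mat ι, ∃ ε : ℝ, 0 < ε ∧ AuxDom Av B ∧
    (T + Tᴴ - (2 : ℝ) • ∑ i, B i - ε • (1 : Mat ι)).PosSemidef}

lemma aux_smul_psd {X : Mat ι} (hX : X.PosSemidef) {a : ℝ} (ha : 0 ≤ a) : (a • X).PosSemidef :=
  hX.smul ha

lemma aux_dom_psd {n : ℕ} {Av B : Fin n → Mat ι} (h : AuxDom Av B) (i : Fin n) :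
    (B i).PosSemidef := by
  have := aux_smul_psd ((h i).1.add (h i).2) (a := 1 / 2) (by norm_num)
  convert this using 1
  module

lemma aux_K_convex {n : ℕ} (Av : Fin n → Mat ι) : Convex ℝ (AuxK Av) := by
  rintro T₁ ⟨B₁, ε₁, hε₁, hB₁, h₁⟩ T₂ ⟨B₂, ε₂, hε₂, hB₂, h₂⟩ a b ha hb hab
  refine ⟨fun i => a • B₁ i + b • B₂ i, a * ε₁ + b * ε₂, ?_, ?_, ?_⟩
  · rcases eq_or_lt_of_le ha with rfl | ha'
    · have : b = 1 := by linarith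
      subst this
      simpa using hε₂
    · have := mul_pos ha' hε₁
      have := mul_nonneg hb hε₂.le
      linarith
  · intro i
    have hb' : b = 1 - a := by linarith
    constructor
    · have := (aux_smul_psd (hB₁ i).1 ha).add (aux_smul_psd (hB₂ i).1 hb)
      convert this using 1
      subst hb'
      module
    · have := (aux_smul_psd (hB₁ i).2 ha).add (aux_smul_psd (hB₂ i).2 hb)
      convert this using 1
      subst hb'
      module
  · have := (aux_smul_psd h₁ ha).add (aux_smul_psd h₂ hb)
    convert this using 1
    rw [Finset.sum_add_distrib, ← Finset.smul_sum, ← Finset.smul_sum, Matrix.conjTranspose_add,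
      Matrix.conjTranspose_smul, Matrix.conjTranspose_smul]
    simp only [star_trivial]
    module

lemma aux_K_open {n : ℕ} (Av : Fin n → Mat ι) : IsOpen (AuxK Av) := by
  rw [isOpen_iff_mem_nhds]
  rintro T ⟨B, ε, hε, hB, h⟩
  have hcont : Continuous (fun T' : Mat ι =>
      (((T + Tᴴ) - (T' + T'ᴴ)) * ((T + Tᴴ) - (T' + T'ᴴ))).trace.re) := by
    fun_prop
  have h0 : (((T + Tᴴ) - (T + Tᴴ)) * ((T + Tᴴ) - (T + Tᴴ))).trace.re < (ε / 2) ^ 2 := by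
    simp
    positivity
  filter_upwards [hcont.continuousAt.eventually_lt continuousAt_const h0] with T' hT'
  refine ⟨B, ε / 2, by positivity, hB, ?_⟩
  have hH : ((T + Tᴴ) - (T' + T'ᴴ)).IsHermitian :=
    (Matrix.isHermitian_add_transpose_self T).sub (Matrix.isHermitian_add_transpose_self T')
  have := h.add (aux_hs_bound hH (by positivity) hT'.le)
  convert this using 1
  module

lemma aux_dom_exists {n : ℕ} (Av : Fin n → Mat ι) (hherm : ∀ i, (Av i).IsHermitian) :
    ∃ B : Fin n → Mat ι, AuxDom Av B :=
  ⟨fun i => (Matrix.posSemidef_conjTranspose_mul_self (Av i)).sqrt, fun i => aux_abs_psd (hherm i)⟩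

/-- Bound on the sums of trace norms. -/
lemma aux_bound {n : ℕ} (Av : Fin n → Mat ι) (hherm : ∀ i, (Av i).IsHermitian) :
    ∃ c : ℝ, ∀ (σ : Mat ι) (h : σ.PosSemidef), σ.trace = 1 →
      ∑ i, traceNorm (h.sqrt * Av i * h.sqrt) ≤ c := by
  have h1 : ∀ i, ∃ c : ℝ, (c • (1 : Mat ι) - Av i).PosSemidef ∧
      (c • (1 : Mat ι) + Av i).PosSemidef := by
    intro i
    have hp : 0 ≤ (Av i * Av i).trace.re := by
      have := (Complex.le_def.1 (Matrix.posSemidef_conjTranspose_mul_self (Av i)).trace_nonneg).1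
      rwa [(hherm i).eq] at this
    refine ⟨Real.sqrt (Av i * Av i).trace.re, ?_, ?_⟩
    · exact aux_hs_bound (hherm i) (Real.sqrt_nonneg _) (Real.sq_sqrt hp).ge
    · have := aux_hs_bound (hherm i).neg (Real.sqrt_nonneg (Av i * Av i).trace.re)
        (by rw [neg_mul_neg, Real.sq_sqrt hp])
      simpa using this
  choose c hc using h1
  refine ⟨∑ i, c i, fun σ h hσ => Finset.sum_le_sum fun i _ => ?_⟩
  have hs := (aux_sqrt_psd h).1.eq
  have e1 := (hc i).1.mul_mul_conjTranspose_same h.sqrt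
  have e2 := (hc i).2.mul_mul_conjTranspose_same h.sqrt
  have hX : (h.sqrt * Av i * h.sqrt).IsHermitian := by
    have := Matrix.isHermitian_mul_mul_conjTranspose h.sqrt (hherm i)
    rwa [hs] at this
  have e3 : h.sqrt * (c i • (1 : Mat ι)) * h.sqrt = c i • σ := by
    rw [Matrix.mul_smul, Matrix.mul_one, Matrix.smul_mul, aux_sqrt_mul]
  rw [hs, Matrix.mul_sub, Matrix.sub_mul, e3] at e1
  rw [hs, Matrix.mul_add, Matrix.add_mul, e3] at e2
  have := aux_traceNorm_le hX e1 e2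
  rw [Matrix.trace_smul, hσ] at this
  simpa using this

/-- A real functional restricted to Hermitian matrices is given by a Hermitian matrix. -/
lemma aux_rep_herm (f : Mat ι →L[ℝ] ℝ) : ∃ σ : Mat ι, σ.IsHermitian ∧
    ∀ H : Mat ι, H.IsHermitian → f H = (σ * H).trace.re := by
  have hF := aux_rep (fun a => Module.Dual.extendRCLike (𝕜 := ℂ) (f : Mat ι →ₗ[ℝ] ℝ) a)
    (Module.Dual.extendRCLike (𝕜 := ℂ) (f : Mat ι →ₗ[ℝ] ℝ)).isLinear
  set σ₀ : Mat ι := Matrix.of fun j k =>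
    Module.Dual.extendRCLike (𝕜 := ℂ) (f : Mat ι →ₗ[ℝ] ℝ) (Matrix.single k j 1) with hσ₀
  have hf : ∀ a, f a = (σ₀ * a).trace.re := by
    intro a
    rw [← hF a]
    exact (Module.Dual.re_extendRCLike_apply (𝕜 := ℂ) (f : Mat ι →ₗ[ℝ] ℝ) a).symm
  refine ⟨(1 / 2 : ℝ) • (σ₀ + σ₀ᴴ), ?_, ?_⟩
  · unfold Matrix.IsHermitian
    rw [Matrix.conjTranspose_smul, Matrix.conjTranspose_add, Matrix.conjTranspose_conjTranspose,
      star_trivial, add_comm]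
  · intro H hH
    have h1 : (σ₀ᴴ * H).trace.re = (σ₀ * H).trace.re := by
      have : (σ₀ᴴ * H).trace = star ((σ₀ * H).trace) := by
        rw [← Matrix.trace_conjTranspose, Matrix.conjTranspose_mul, hH.eq, Matrix.trace_mul_comm]
      rw [this]
      simp
    rw [Matrix.smul_mul, Matrix.trace_smul, Complex.smul_re, Matrix.add_mul, Matrix.trace_add,
      Complex.add_re, h1, hf, smul_eq_mul]
    ring

lemma aux_E_dom {n : ℕ} (A : FdSubalgebra ι) {Av B : Fin n → Mat ι} (hmem : ∀ i, Av i ∈ A.car)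
    (hB : AuxDom Av B) : AuxDom Av (fun i => A.E (B i)) := by
  intro i
  constructor
  · have := aux_E_psd A (hB i).1
    rwa [aux_E_sub, A.E_fix _ (hmem i)] at this
  · have := aux_E_psd A (hB i).2
    rwa [A.E_linear.map_add, A.E_fix _ (hmem i)] at this

/-- The optimal dominating family for an invertible state. -/
lemma aux_opt {n : ℕ} (Av : Fin n → Mat ι) (hherm : ∀ i, (Av i).IsHermitian) {τ : Mat ι}
    (hτ : τ.PosDef) (h : τ.PosSemidef) : ∃ B : Fin n → Mat ι, AuxDom Av B ∧
      (τ * ∑ i, B i).trace.re = ∑ i, traceNorm (h.sqrt * Av i * h.sqrt) := by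
  set R := h.sqrt with hR
  have hRR : R * R = τ := aux_sqrt_mul h
  have hRH : Rᴴ = R := (aux_sqrt_psd h).1.eq
  have hRu : IsUnit R := by
    have h1 : IsUnit (R * R) := hRR ▸ hτ.isUnit
    exact isUnit_of_mul_isUnit_left h1
  have hd : IsUnit R.det := (Matrix.isUnit_iff_isUnit_det R).1 hRu
  have hi1 : R⁻¹ * R = 1 := Matrix.nonsing_inv_mul R hd
  have hi2 : R * R⁻¹ = 1 := Matrix.mul_nonsing_inv R hd
  have hiH : (R⁻¹)ᴴ = R⁻¹ := by rw [Matrix.conjTranspose_nonsing_inv, hRH]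
  have hX : ∀ i, (R * Av i * R).IsHermitian := by
    intro i
    have := Matrix.isHermitian_mul_mul_conjTranspose R (hherm i)
    rwa [hRH] at this
  have hA : ∀ i, R⁻¹ * (R * Av i * R) * R⁻¹ = Av i := by
    intro i
    calc R⁻¹ * (R * Av i * R) * R⁻¹ = (R⁻¹ * R) * Av i * (R * R⁻¹) := by
          simp only [Matrix.mul_assoc]
      _ = Av i := by rw [hi1, hi2, Matrix.one_mul, Matrix.mul_one]
  refine ⟨fun i => R⁻¹ * (Matrix.posSemidef_conjTranspose_mul_self (R * Av i * R)).sqrt * R⁻¹,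
    fun i => ⟨?_, ?_⟩, ?_⟩
  · have := (aux_abs_psd (hX i)).1.mul_mul_conjTranspose_same R⁻¹
    rwa [hiH, Matrix.mul_sub, Matrix.sub_mul, hA] at this
  · have := (aux_abs_psd (hX i)).2.mul_mul_conjTranspose_same R⁻¹
    rwa [hiH, Matrix.mul_add, Matrix.add_mul, hA] at this
  · rw [Matrix.mul_sum, Matrix.trace_sum, Complex.re_sum]
    refine Finset.sum_congr rfl fun i _ => ?_
    unfold traceNorm
    congr 1
    generalize (Matrix.posSemidef_conjTranspose_mul_self (R * Av i * R)).sqrt = P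
    calc (τ * (R⁻¹ * P * R⁻¹)).trace = (R * ((R * R⁻¹) * P * R⁻¹)).trace := by
          rw [← hRR]; simp only [Matrix.mul_assoc]
      _ = P.trace := by
          rw [hi2, Matrix.one_mul, Matrix.trace_mul_comm, Matrix.mul_assoc, hi1, Matrix.mul_one]

lemma aux_sep {n : ℕ} (A : FdSubalgebra ι) (Av : Fin n → Mat ι) (hmem : ∀ i, Av i ∈ A.car)
    (hherm : ∀ i, (Av i).IsHermitian) {S l : ℝ} (hS0 : 0 ≤ S) (hl : S < l)
    (hS : ∀ (σ : Mat ι) (h : σ.PosSemidef), σ ∈ A.car → σ.trace = 1 →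
      ∑ i, traceNorm (h.sqrt * Av i * h.sqrt) ≤ S) :
    ∃ B : Fin n → Mat ι, AuxDom Av B ∧ (l • (1 : Mat ι) - ∑ i, B i).PosSemidef := by
  have hl0 : 0 < l := by linarith
  by_cases hK : l • (1 : Mat ι) ∈ AuxK Av
  · obtain ⟨B, ε, hε, hB, h⟩ := hK
    refine ⟨B, hB, ?_⟩
    have := aux_smul_psd (h.add (aux_smul_psd Matrix.PosSemidef.one hε.le)) (a := 1 / 2)
      (by norm_num)
    convert this using 1
    rw [Matrix.conjTranspose_smul, Matrix.conjTranspose_one, star_trivial]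
    module
  exfalso
  obtain ⟨f, hf⟩ := geometric_hahn_banach_point_open (aux_K_convex Av) (aux_K_open Av) hK
  obtain ⟨σ, hσH, hσ⟩ := aux_rep_herm f
  have h1H : (1 : Mat ι).IsHermitian := Matrix.isHermitian_one
  have key : ∀ (B : Fin n → Mat ι) (ε : ℝ) (Q : Mat ι), AuxDom Av B → 0 < ε → Q.PosSemidef →
      l * σ.trace.re < (σ * ∑ i, B i).trace.re + ε * σ.trace.re + (σ * Q).trace.re := by
    intro B ε Q hB hε hQ
    have hBs : (∑ i, B i).PosSemidef :=
      Matrix.posSemidef_sum _ fun i _ => aux_dom_psd hB i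
    have hT : ((∑ i, B i) + ε • (1 : Mat ι) + Q).PosSemidef :=
      (hBs.add (aux_smul_psd Matrix.PosSemidef.one hε.le)).add hQ
    have := hf ((∑ i, B i) + ε • (1 : Mat ι) + Q) (by
      refine ⟨B, ε, hε, hB, ?_⟩
      rw [hT.1.eq]
      have := (aux_smul_psd (Matrix.PosSemidef.one (n := ι) (R := ℂ)) hε.le).add
        (aux_smul_psd hQ (a := 2) (by norm_num))
      convert this using 1
      module)
    rw [hσ _ hT.1, hσ _ (aux_smul_psd Matrix.PosSemidef.one hl0.le).1] at this
    simpa [Matrix.mul_add, Matrix.mul_smul, Matrix.trace_add, Matrix.trace_smul] using this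
  obtain ⟨B₀, hB₀⟩ := aux_dom_exists Av hherm
  have hpsd : σ.PosSemidef := by
    refine aux_psd_of_trace hσH fun Q hQ => ?_
    by_contra hneg
    push Not at hneg
    set C := (σ * ∑ i, B₀ i).trace.re + 1 * σ.trace.re - l * σ.trace.re with hC
    have ht : 0 ≤ |C| / (-(σ * Q).trace.re) := div_nonneg (abs_nonneg _) (by linarith)
    have := key B₀ 1 _ hB₀ one_pos (aux_smul_psd hQ ht)
    rw [Matrix.mul_smul, Matrix.trace_smul, Complex.smul_re, smul_eq_mul] at this
    have e : |C| / (-(σ * Q).trace.re) * (σ * Q).trace.re = -|C| := by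
      have : (σ * Q).trace.re ≠ 0 := hneg.ne
      field_simp
    rw [e] at this
    linarith [le_abs_self C]
  have htr := Complex.le_def.1 hpsd.trace_nonneg
  set s := σ.trace.re with hs
  have hsC : σ.trace = (s : ℂ) := by
    apply Complex.ext
    · simp [hs]
    · simpa using htr.2.symm
  have hs0 : 0 < s := by
    rcases eq_or_lt_of_le (show 0 ≤ s from htr.1) with h0 | h0
    · have : σ = 0 := by
        rw [← hpsd.trace_eq_zero_iff, hsC, ← h0]; simp
      have h2 := key B₀ 1 0 hB₀ one_pos Matrix.PosSemidef.zero
      rw [← h0, this] at h2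
      simp at h2
    · exact h0
  have key2 : ∀ B : Fin n → Mat ι, AuxDom Av B → l * s ≤ (σ * ∑ i, B i).trace.re := by
    intro B hB
    refine le_of_forall_pos_le_add fun ε hε => ?_
    have := key B (ε / s) 0 hB (div_pos hε hs0) Matrix.PosSemidef.zero
    rw [div_mul_cancel₀ _ hs0.ne'] at this
    simp at this
    exact this.le
  have hne : Nonempty ι := by
    by_contra hempty
    rw [not_nonempty_iff] at hempty
    have : σ.trace = 0 := by simp [Matrix.trace]
    rw [hs, this] at hs0
    simp at hs0
  -- the averaged state
  have key3 : ∀ B : Fin n → Mat ι, AuxDom Av B →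
      l ≤ ((s⁻¹ • A.E σ) * ∑ i, B i).trace.re := by
    intro B hB
    have h1 := key2 _ (aux_E_dom A hmem hB)
    rw [← aux_E_sum, ← aux_E_symm] at h1
    rw [Matrix.smul_mul, Matrix.trace_smul, Complex.smul_re, smul_eq_mul]
    calc l = s⁻¹ * (l * s) := by field_simp
      _ ≤ _ := mul_le_mul_of_nonneg_left h1 (inv_nonneg.2 hs0.le)
  have hτ : (s⁻¹ • A.E σ).PosSemidef := aux_smul_psd (aux_E_psd A hpsd) (inv_nonneg.2 hs0.le)
  have hτt : (s⁻¹ • A.E σ).trace = 1 := by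
    rw [Matrix.trace_smul, aux_E_trace', hsC, Complex.real_smul, ← Complex.ofReal_mul,
      inv_mul_cancel₀ hs0.ne', Complex.ofReal_one]
  have hτm : s⁻¹ • A.E σ ∈ A.car := by
    rw [← Complex.coe_smul]
    exact A.smul_mem _ (A.E_mem _)
  generalize s⁻¹ • A.E σ = τ at key3 hτ hτt hτm
  have hd : (0 : ℝ) < Fintype.card ι := by exact_mod_cast Fintype.card_pos
  set ε := (l - S) / (2 * l) with hε
  have hε0 : 0 < ε := div_pos (by linarith) (by linarith)
  have hε1 : ε < 1 := by rw [hε, div_lt_one (by linarith)]; linarith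
  have hεl : ε * l = (l - S) / 2 := by rw [hε]; field_simp
  have hc0 : 0 < ε / Fintype.card ι := div_pos hε0 hd
  set τ' := (1 - ε) • τ + (ε / Fintype.card ι) • (1 : Mat ι) with hτ'
  have hpd : τ'.PosDef := Matrix.PosDef.posSemidef_add (aux_smul_psd hτ (by linarith))
    (Matrix.PosDef.one.smul hc0)
  have htr' : τ'.trace = 1 := by
    rw [hτ', Matrix.trace_add, Matrix.trace_smul, Matrix.trace_smul, hτt, Matrix.trace_one,
      Complex.real_smul, Complex.real_smul]
    have : (Fintype.card ι : ℂ) ≠ 0 := by exact_mod_cast Fintype.card_pos.ne'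
    push_cast
    field_simp
    ring
  have hm' : τ' ∈ A.car := by
    rw [hτ', ← Complex.coe_smul, ← Complex.coe_smul]
    exact A.add_mem (A.smul_mem _ hτm) (A.smul_mem _ A.one_mem)
  obtain ⟨B, hB, hBt⟩ := aux_opt Av hherm hpd hpd.posSemidef
  have h1 := hS τ' hpd.posSemidef hm' htr'
  rw [← hBt] at h1
  have h2 := key3 B hB
  have h3 : 0 ≤ (∑ i, B i).trace.re :=
    (Complex.le_def.1 (Matrix.posSemidef_sum _ fun i _ => aux_dom_psd hB i).trace_nonneg).1
  have h4 : (τ' * ∑ i, B i).trace.re =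
      (1 - ε) * (τ * ∑ i, B i).trace.re + (ε / Fintype.card ι) * (∑ i, B i).trace.re := by
    rw [hτ', Matrix.add_mul, Matrix.smul_mul, Matrix.smul_mul, Matrix.one_mul, Matrix.trace_add,
      Matrix.trace_smul, Matrix.trace_smul, Complex.add_re, Complex.smul_re, Complex.smul_re,
      smul_eq_mul, smul_eq_mul]
  have h5 := mul_nonneg hc0.le h3
  have h6 := mul_le_mul_of_nonneg_left h2 (show 0 ≤ 1 - ε by linarith)
  nlinarith

end Helpers

section Helpers2
variable {ι : Type} [Fintype ι] [DecidableEq ι]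

lemma aux_qc_mem {n : ℕ} (Pf : AdmissibleFamily) (A : FdSubalgebra ι) {M : Fin n → Mat ι}
    (hM : ∀ i, (M i).PosSemidef) (hm : ∀ i, M i ∈ A.car) :
    PhiQC M ∈ PL Pf A (FdSubalgebra.diag n) := by
  refine ⟨Pf.eb_le _ _ ⟨n, M, fun i => Matrix.single i i 1, hM, fun i => ?_, ?_⟩, ?_, ?_⟩
  · beta_reduce
    rw [← Matrix.diagonal_single, Matrix.posSemidef_diagonal_iff]
    intro j
    by_cases h : j = i
    · subst h; simp
    · simp [h]
  · funext a
    ext j k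
    simp only [PhiQC, Matrix.sum_apply, Matrix.smul_apply, Matrix.single_apply, smul_eq_mul]
    by_cases h : j = k
    · subst h
      simp
    · rw [Matrix.diagonal_apply_ne _ h]
      symm
      refine Finset.sum_eq_zero fun i _ => ?_
      rw [if_neg (fun h' => h (h'.1.symm.trans h'.2)), mul_zero]
  · intro a i j hij
    exact Matrix.diagonal_apply_ne _ hij
  · intro a
    unfold PhiQC
    congr 1
    funext i
    rw [Matrix.trace_mul_comm, A.E_trace _ _ (hm i), Matrix.trace_mul_comm]

lemma aux_upper {n : ℕ} (hn : 0 < n) (Pf : AdmissibleFamily) (A : FdSubalgebra ι)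
    (Av : Fin n → Mat ι) (hmem : ∀ i, Av i ∈ A.car)
    (hherm : ∀ i, (Av i).IsHermitian) {S l : ℝ} (hS0 : 0 ≤ S) (hl : S < l)
    (hS : ∀ (σ : Mat ι) (h : σ.PosSemidef), σ ∈ A.car → σ.trace = 1 →
      ∑ i, traceNorm (h.sqrt * Av i * h.sqrt) ≤ S) :
    ∃ α ∈ ChanP Pf A (FdSubalgebra.diag n),
      (l • α - PhiQC Av) ∈ PL Pf A (FdSubalgebra.diag n) ∧
      (l • α + PhiQC Av) ∈ PL Pf A (FdSubalgebra.diag n) := by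
  obtain ⟨B, hB, hBl⟩ := aux_sep A Av hmem hherm hS0 hl hS
  have hl0 : 0 < l := by linarith
  have hn0 : (0 : ℝ) < n := by exact_mod_cast hn
  have hEB := aux_E_dom A hmem hB
  have hsm : ∀ (c : ℝ) (x : Mat ι), x ∈ A.car → c • x ∈ A.car := by
    intro c x hx
    rw [← Complex.coe_smul]
    exact A.smul_mem _ hx
  set D := l • (1 : Mat ι) - ∑ i, A.E (B i) with hD
  have hDE : D = A.E (l • (1 : Mat ι) - ∑ i, B i) := by
    rw [aux_E_sub, aux_E_sum, A.E_fix _ (hsm _ _ A.one_mem)]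
  have hDp : D.PosSemidef := hDE ▸ aux_E_psd A hBl
  have hDm : D ∈ A.car := hDE ▸ A.E_mem _
  have hDn : ((n : ℝ)⁻¹ • D).PosSemidef := aux_smul_psd hDp (inv_nonneg.2 hn0.le)
  set M : Fin n → Mat ι := fun i => l⁻¹ • (A.E (B i) + (n : ℝ)⁻¹ • D) with hM
  have hlM : ∀ i, l • M i = A.E (B i) + (n : ℝ)⁻¹ • D := by
    intro i
    rw [hM, smul_smul, mul_inv_cancel₀ hl0.ne', one_smul]
  have hMp : ∀ i, (M i).PosSemidef := fun i =>
    aux_smul_psd ((aux_dom_psd hEB i).add hDn) (inv_nonneg.2 hl0.le)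
  have hMm : ∀ i, M i ∈ A.car := fun i =>
    hsm _ _ (A.add_mem (A.E_mem _) (hsm _ _ hDm))
  have hMs : ∑ i, M i = 1 := by
    rw [hM, ← Finset.smul_sum, Finset.sum_add_distrib, Finset.sum_const, Finset.card_univ,
      Fintype.card_fin, ← Nat.cast_smul_eq_nsmul ℝ, smul_smul, mul_inv_cancel₀ hn0.ne', one_smul,
      hD, add_sub_cancel, smul_smul, inv_mul_cancel₀ hl0.ne', one_smul]
  refine ⟨PhiQC M, ⟨aux_qc_mem Pf A hMp hMm, ?_⟩, ?_, ?_⟩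
  · intro a
    unfold PhiQC
    rw [Matrix.trace_diagonal, ← Matrix.trace_sum, ← Matrix.sum_mul, hMs, Matrix.one_mul]
  · have e : l • PhiQC M - PhiQC Av = PhiQC (fun i => l • M i - Av i) := by
      funext a
      ext j k
      by_cases h : j = k
      · subst h
        simp [PhiQC, Matrix.sub_mul, Matrix.trace_sub, Matrix.trace_smul]
      · simp [PhiQC, h]
    rw [e]
    refine aux_qc_mem Pf A (fun i => ?_) (fun i => ?_)
    · have := (hEB i).1.add hDn
      rw [hlM]
      convert this using 1
      module
    · have := A.add_mem (hsm l _ (hMm i)) (hsm (-1) _ (hmem i))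
      simpa [sub_eq_add_neg] using this
  · have e : l • PhiQC M + PhiQC Av = PhiQC (fun i => l • M i + Av i) := by
      funext a
      ext j k
      by_cases h : j = k
      · subst h
        simp [PhiQC, Matrix.add_mul, Matrix.trace_add, Matrix.trace_smul]
      · simp [PhiQC, h]
    rw [e]
    refine aux_qc_mem Pf A (fun i => ?_) (fun i => ?_)
    · have := (hEB i).2.add hDn
      rw [hlM]
      convert this using 1
      module
    · exact A.add_mem (hsm l _ (hMm i)) (hmem i)

lemma aux_lower {n : ℕ} (Pf : AdmissibleFamily) (A : FdSubalgebra ι)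
    (Av : Fin n → Mat ι) (hherm : ∀ i, (Av i).IsHermitian) {l : ℝ}
    {α : HMap ι (Fin n)} (hα : α ∈ ChanP Pf A (FdSubalgebra.diag n))
    (h1 : (l • α - PhiQC Av) ∈ PL Pf A (FdSubalgebra.diag n))
    (h2 : (l • α + PhiQC Av) ∈ PL Pf A (FdSubalgebra.diag n))
    (σ : Mat ι) (h : σ.PosSemidef) (hσ : σ.trace = 1) :
    ∑ i, traceNorm (h.sqrt * Av i * h.sqrt) ≤ l := by
  obtain ⟨⟨hαP, -⟩, hTP⟩ := hα
  have hp := Pf.le_pos _ _ hαP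
  have hp1 := (Pf.le_pos _ _ h1.1).2
  have hp2 := (Pf.le_pos _ _ h2.1).2
  have hlin : ∀ i, IsLinearMap ℂ (fun a => α a i i) := fun i =>
    ⟨fun x y => by simp [hp.1.1.map_add], fun c x => by simp [hp.1.1.map_smul]⟩
  set M : Fin n → Mat ι := fun i => Matrix.of fun j k => α (Matrix.single k j 1) i i with hM
  have hrep : ∀ i a, α a i i = (M i * a).trace := fun i a =>
    aux_rep (fun a => α a i i) (hlin i) a
  have hMH : ∀ i, (M i).IsHermitian := by
    intro i
    ext j k
    have := congrFun (congrFun (hp.1.2 (Matrix.single j k 1)) i) i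
    simp only [Matrix.conjTranspose_single, star_one, Matrix.conjTranspose_apply] at this
    simp only [hM, Matrix.conjTranspose_apply, Matrix.of_apply]
    exact this.symm
  have hs := (aux_sqrt_psd h).1.eq
  have hlH : ∀ i, (l • M i).IsHermitian := by
    intro i
    unfold Matrix.IsHermitian
    rw [Matrix.conjTranspose_smul, star_trivial, (hMH i).eq]
  have hm1 : ∀ i, (l • M i - Av i).PosSemidef := by
    intro i
    refine aux_psd_of_trace ((hlH i).sub (hherm i)) fun Q hQ => ?_
    have := (Complex.le_def.1 ((hp1 Q hQ).diag_nonneg (i := i))).1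
    simp only [Pi.sub_apply, Pi.smul_apply, Matrix.sub_apply, Matrix.smul_apply, PhiQC,
      Matrix.diagonal_apply_eq, hrep] at this
    rwa [Matrix.sub_mul, Matrix.trace_sub, Matrix.smul_mul, Matrix.trace_smul]
  have hm2 : ∀ i, (l • M i + Av i).PosSemidef := by
    intro i
    refine aux_psd_of_trace ((hlH i).add (hherm i)) fun Q hQ => ?_
    have := (Complex.le_def.1 ((hp2 Q hQ).diag_nonneg (i := i))).1
    simp only [Pi.add_apply, Pi.smul_apply, Matrix.add_apply, Matrix.smul_apply, PhiQC,
      Matrix.diagonal_apply_eq, hrep] at this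
    rwa [Matrix.add_mul, Matrix.trace_add, Matrix.smul_mul, Matrix.trace_smul]
  have hb : ∀ i, traceNorm (h.sqrt * Av i * h.sqrt) ≤ l * (α σ i i).re := by
    intro i
    have hX : (h.sqrt * Av i * h.sqrt).IsHermitian := by
      have := Matrix.isHermitian_mul_mul_conjTranspose h.sqrt (hherm i)
      rwa [hs] at this
    have e1 := (hm1 i).mul_mul_conjTranspose_same h.sqrt
    have e2 := (hm2 i).mul_mul_conjTranspose_same h.sqrt
    rw [hs, Matrix.mul_sub, Matrix.sub_mul] at e1
    rw [hs, Matrix.mul_add, Matrix.add_mul] at e2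
    refine (aux_traceNorm_le hX e1 e2).trans (le_of_eq ?_)
    rw [Matrix.trace_mul_comm, ← Matrix.mul_assoc, aux_sqrt_mul, Matrix.trace_mul_comm,
      Matrix.smul_mul, Matrix.trace_smul, Complex.smul_re, smul_eq_mul, hrep]
  calc ∑ i, traceNorm (h.sqrt * Av i * h.sqrt) ≤ ∑ i, l * (α σ i i).re :=
        Finset.sum_le_sum fun i _ => hb i
    _ = l * (α σ).trace.re := by
        rw [← Finset.mul_sum, Matrix.trace, Complex.re_sum]; rfl
    _ = l := by rw [hTP, hσ]; simp

end Helpers2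


/-- `‖Φ^qc_A‖_◇ = sup_{σ ∈ 𝔖(A)} ∑_i ‖σ^{1/2} A_i σ^{1/2}‖₁` for `A = {A_1,…,A_n} ⊆ A_h`. -/
theorem statement7 (Pf : AdmissibleFamily) {ι : Type} [Fintype ι] [DecidableEq ι]
    (A : FdSubalgebra ι) {n : ℕ} (Av : Fin n → Mat ι)
    (hmem : ∀ i, Av i ∈ A.car) (hherm : ∀ i, (Av i).IsHermitian) :
    dnormP Pf A (FdSubalgebra.diag n) (PhiQC Av) =
      sSup {r : ℝ | ∃ σ : Mat ι, ∃ h : σ.PosSemidef, σ ∈ A.car ∧ σ.trace = 1 ∧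
        r = ∑ i, traceNorm (h.sqrt * Av i * h.sqrt)} := by
  rcases Nat.eq_zero_or_pos n with rfl | hn
  · have hR : sSup {r : ℝ | ∃ σ : Mat ι, ∃ h : σ.PosSemidef, σ ∈ A.car ∧ σ.trace = 1 ∧
        r = ∑ i, traceNorm (h.sqrt * Av i * h.sqrt)} = 0 := by
      refine le_antisymm (Real.sSup_le ?_ le_rfl) (Real.sSup_nonneg ?_)
      · rintro r ⟨σ, h, -, -, rfl⟩; simp
      · rintro r ⟨σ, h, -, -, rfl⟩; simp
    rw [hR]
    unfold dnormP
    by_cases hex : ∃ α, α ∈ ChanP Pf A (FdSubalgebra.diag 0)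
    · obtain ⟨α, hα⟩ := hex
      have hall : ∀ φ : HMap ι (Fin 0), φ ∈ PL Pf A (FdSubalgebra.diag 0) := by
        intro φ
        have : φ = α := by
          funext a
          exact Subsingleton.elim _ _
        rw [this]
        exact hα.1
      have : {l : ℝ | 0 < l ∧ ∃ α ∈ ChanP Pf A (FdSubalgebra.diag 0),
          (l • α - PhiQC Av) ∈ PL Pf A (FdSubalgebra.diag 0) ∧
          (l • α + PhiQC Av) ∈ PL Pf A (FdSubalgebra.diag 0)} = Set.Ioi 0 := by
        ext l
        exact ⟨fun h => h.1, fun h => ⟨h, α, hα, hall _, hall _⟩⟩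
      rw [this, csInf_Ioi]
    · have : {l : ℝ | 0 < l ∧ ∃ α ∈ ChanP Pf A (FdSubalgebra.diag 0),
          (l • α - PhiQC Av) ∈ PL Pf A (FdSubalgebra.diag 0) ∧
          (l • α + PhiQC Av) ∈ PL Pf A (FdSubalgebra.diag 0)} = ∅ := by
        ext l
        simp only [Set.mem_setOf_eq, Set.mem_empty_iff_false, iff_false]
        rintro ⟨-, α, hα, -⟩
        exact hex ⟨α, hα⟩
      rw [this, Real.sInf_empty]
  · set S := sSup {r : ℝ | ∃ σ : Mat ι, ∃ h : σ.PosSemidef, σ ∈ A.car ∧ σ.trace = 1 ∧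
        r = ∑ i, traceNorm (h.sqrt * Av i * h.sqrt)} with hSdef
    have hS0 : 0 ≤ S := by
      refine Real.sSup_nonneg ?_
      rintro r ⟨σ, h, -, -, rfl⟩
      exact Finset.sum_nonneg fun i _ => aux_traceNorm_nonneg _
    obtain ⟨c, hc⟩ := aux_bound Av hherm
    have hS : ∀ (σ : Mat ι) (h : σ.PosSemidef), σ ∈ A.car → σ.trace = 1 →
        ∑ i, traceNorm (h.sqrt * Av i * h.sqrt) ≤ S := by
      intro σ h hm ht
      refine le_csSup ⟨c, ?_⟩ ⟨σ, h, hm, ht, rfl⟩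
      rintro r ⟨σ', h', -, ht', rfl⟩
      exact hc σ' h' ht'
    have hin : ∀ l, S < l → l ∈ {l : ℝ | 0 < l ∧ ∃ α ∈ ChanP Pf A (FdSubalgebra.diag n),
        (l • α - PhiQC Av) ∈ PL Pf A (FdSubalgebra.diag n) ∧
        (l • α + PhiQC Av) ∈ PL Pf A (FdSubalgebra.diag n)} := fun l hl =>
      ⟨by linarith, aux_upper hn Pf A Av hmem hherm hS0 hl hS⟩
    unfold dnormP
    apply le_antisymm
    · refine le_of_forall_gt_imp_ge_of_dense fun l hl => ?_
      exact csInf_le ⟨0, fun x hx => hx.1.le⟩ (hin l hl)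
    · refine le_csInf ⟨S + 1, hin _ (by linarith)⟩ ?_
      rintro l ⟨hl, α, hα, h1, h2⟩
      refine Real.sSup_le ?_ hl.le
      rintro r ⟨σ, h, -, ht, rfl⟩
      exact aux_lower Pf A Av hherm hα h1 h2 σ h ht
end
end
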